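/- arXiv:1105.0270 — 3 statements merged into one kernel-verified Lean document; each statement's English description precedes it below -/
import Mathlib

section
/- Under Conditions A and Conditions B there exists N0 > 0 such that the set D := V × {y ∈ 𝒴 : L2(y) ≤ N0} is positive recurrent for the Markov chain {(X^t,Y^t)}: the hitting time τ_D := min{t ≥ 1 : (X^t,Y^t) ∈ D} is P_{x,y}-a.s. finite for every initial state (x,y) ∈ 𝒳×𝒴, and sup_{(x,y)∈D} E_{x,y}[τ_D] < ∞. -/
open MeasureTheory ProbabilityTheory Filter Set
open scoped ENNReal

noncomputable section

/-- First hitting time (at a time `≥ 1`) of a set along a trajectory, valued in `ℝ≥0∞`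
(`∞` if the set is never hit). -/
def hitTime {S : Type*} (V : Set S) (ω : ℕ → S) : ℝ≥0∞ :=
  sInf {r : ℝ≥0∞ | ∃ n : ℕ, r = n ∧ 1 ≤ n ∧ ω n ∈ V}

/-- A time-homogeneous Markov chain, given by the family of its path-space laws
`P z` (the law of the whole trajectory when started at `z`). -/
structure MarkovFamily (S : Type*) [MeasurableSpace S] where
  P : S → Measure (ℕ → S)
  prob : ∀ z, IsProbabilityMeasure (P z)
  meas : Measurable P
  start : ∀ z, P z {ω | ω 0 = z} = 1
  markov : ∀ (z : S) (n : ℕ) (B : Set (ℕ → S)),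
      MeasurableSet[MeasurableSpace.comap (fun (ω : ℕ → S) (i : Fin (n+1)) => ω i) inferInstance] B →
      ∀ A : Set (ℕ → S), MeasurableSet A →
        P z (B ∩ {ω | (fun k => ω (n + k)) ∈ A}) = ∫⁻ ω in B, P (ω n) A ∂ P z

/-- A set `D` is positive recurrent for the chain: the hitting time of `D` is a.s. finite
from every initial state, and its expectation is bounded uniformly over initial states in `D`. -/
def PosRec {S : Type*} [MeasurableSpace S] (F : MarkovFamily S) (D : Set S) : Prop :=
  (∀ z, F.P z {ω | hitTime D ω < ⊤} = 1) ∧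
  ∃ C : ℝ≥0∞, C < ⊤ ∧ ∀ z ∈ D, ∫⁻ ω, hitTime D ω ∂ F.P z ≤ C


variable {X Y : Type*} [MeasurableSpace X] [MeasurableSpace Y]

open Classical in
/-- The expected hitting time of `V` (at a time `≥ 1`), as the test function `L1`:
`L1 x = E_x τ_V` for `x ∉ V` and `L1 x = 0` for `x ∈ V`. -/
def L1fun (XC : MarkovFamily X) (V : Set X) (x : X) : ℝ≥0∞ :=
  if x ∈ V then 0 else ∫⁻ ω, hitTime V ω ∂ XC.P x

/-- Conditions A of the paper for the two-component chain `chain` on `X × Y` whose first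
component is the autonomous Markov chain `XC`:  autonomy of the `X`-component (A0), positive
recurrence of the set `V` for the `X`-chain, existence of a stationary distribution `π` for the
`X`-chain with convergence to it in total variation from every point, uniformly over `V`, and
sublinear growth of `E_x L1(X^t)` uniformly over `x ∈ V`. -/
def CondA (chain : MarkovFamily (X × Y)) (XC : MarkovFamily X) (V : Set X)
    (π : Measure X) : Prop :=
  MeasurableSet V ∧
  -- A0 : the X-component evolves autonomously, with path law `XC.P x` for any initial `y`
  (∀ x y, Measure.map (fun (ω : ℕ → X × Y) (n : ℕ) => (ω n).1) (chain.P (x, y)) = XC.P x) ∧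
  -- the hitting time of V is a.s. finite from every initial state
  (∀ x, XC.P x {ω | hitTime V ω < ⊤} = 1) ∧
  -- and its expectation is uniformly bounded on V
  (∃ s0 : ℝ≥0∞, s0 < ⊤ ∧ ∀ x ∈ V, ∫⁻ ω, hitTime V ω ∂ XC.P x ≤ s0) ∧
  -- π is a stationary distribution of the X-chain
  IsProbabilityMeasure π ∧
  (∀ B : Set X, MeasurableSet B → ∫⁻ x, XC.P x {ω | ω 1 ∈ B} ∂π = π B) ∧
  -- convergence to π in total variation from every initial state
  (∀ x, ∀ ε : ℝ, 0 < ε → ∃ T : ℕ, ∀ t ≥ T, ∀ B : Set X, MeasurableSet B →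
      |(XC.P x {ω | ω t ∈ B}).toReal - (π B).toReal| ≤ ε) ∧
  -- uniformly over x ∈ V
  (∀ ε : ℝ, 0 < ε → ∃ T : ℕ, ∀ t ≥ T, ∀ x ∈ V, ∀ B : Set X, MeasurableSet B →
      |(XC.P x {ω | ω t ∈ B}).toReal - (π B).toReal| ≤ ε) ∧
  -- (1/t) sup_{x ∈ V} E_x L1(X^t) → 0
  (∀ ε : ℝ, 0 < ε → ∃ T : ℕ, ∀ t ≥ T, ∀ x ∈ V,
      ∫⁻ ω, L1fun XC V (ω t) ∂ XC.P x ≤ ENNReal.ofReal (ε * t))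

/-- Condition B1 of the paper: the absolute increments of `L2` along the `Y`-component
have expectations bounded by `U`, uniformly in the initial state. -/
def CondB1 (chain : MarkovFamily (X × Y)) (L2 : Y → ℝ) (U : ℝ) : Prop :=
  Measurable L2 ∧ (∀ y, 0 ≤ L2 y) ∧
  ∀ (x : X) (y : Y),
    ∫⁻ ω, ENNReal.ofReal |L2 (ω 1).2 - L2 y| ∂ chain.P (x, y) ≤ ENNReal.ofReal U

/-- Condition B2 of the paper: a drift inequality
`E_{x,y}[L2(Y^1) - L2(y)] ≤ f x + h (L2 y)` with `h ↓ 0` and `∫ f dπ = -ε < 0`. -/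
def CondB2 (chain : MarkovFamily (X × Y)) (π : Measure X) (L2 : Y → ℝ)
    (h : ℝ → ℝ) (f : X → ℝ) (ε : ℝ) : Prop :=
  Antitone h ∧ (∀ r : ℝ, 0 ≤ h r) ∧ Tendsto h atTop (nhds 0) ∧
  Measurable f ∧ (∃ K : ℝ, ∀ x, |f x| ≤ K) ∧
  0 < ε ∧ (∫ x, f x ∂π = -ε) ∧
  ∀ (x : X) (y : Y),
    ∫ ω, (L2 (ω 1).2 - L2 y) ∂ chain.P (x, y) ≤ f x + h (L2 y)

end

lemma MarkovFamily.lintegral_shift {S : Type*} [MeasurableSpace S] (F : MarkovFamily S) (z : S)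
    (n : ℕ) (g : (ℕ → S) → ℝ≥0∞) (hg : Measurable g) :
    ∫⁻ ω, g (fun k => ω (n + k)) ∂F.P z = ∫⁻ ω, ∫⁻ ω', g ω' ∂F.P (ω n) ∂F.P z := by
  have hsh : Measurable (fun (ω : ℕ → S) (k : ℕ) => ω (n + k)) := by fun_prop
  have hk : Measurable (fun ω : ℕ → S => F.P (ω n)) := F.meas.comp (measurable_pi_apply n)
  have hmap : Measure.map (fun (ω : ℕ → S) (k : ℕ) => ω (n + k)) (F.P z)
      = Measure.bind (F.P z) (fun ω => F.P (ω n)) := by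
    ext A hA
    rw [Measure.map_apply hsh hA, Measure.bind_apply hA hk.aemeasurable]
    have := F.markov z n univ MeasurableSet.univ A hA
    rw [univ_inter, setLIntegral_univ] at this
    exact this
  rw [← lintegral_map (f := g) hg hsh, hmap, Measure.lintegral_bind hk.aemeasurable hg.aemeasurable]

lemma MarkovFamily.start_ae {S : Type*} [MeasurableSpace S] (F : MarkovFamily S) (z : S)
    (s : Set S) (hs : MeasurableSet s) (hz : z ∈ s) : ∀ᵐ ω ∂F.P z, ω 0 ∈ s := by
  have := F.prob z
  have hm : MeasurableSet {ω : ℕ → S | ω 0 ∈ s} := measurable_pi_apply 0 hs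
  refine (prob_compl_eq_zero_iff hm).2 (le_antisymm prob_le_one ?_)
  rw [← F.start z]
  apply measure_mono
  intro ω hω
  simp only [mem_ofPred_eq] at hω ⊢
  rwa [hω]

lemma hitTime_eq {S : Type*} (V : Set S) (ω : ℕ → S) [∀ n, Decidable (1 ≤ n ∧ ω n ∈ V)] :
    hitTime V ω = ⨅ n : ℕ, if 1 ≤ n ∧ ω n ∈ V then (n : ℝ≥0∞) else ⊤ := by
  apply le_antisymm
  · refine le_iInf fun n => ?_
    split_ifs with h
    · exact sInf_le ⟨n, rfl, h.1, h.2⟩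
    · exact le_top
  · refine le_sInf ?_
    rintro r ⟨n, rfl, h1, h2⟩
    refine (iInf_le _ n).trans ?_
    rw [if_pos ⟨h1, h2⟩]

lemma measurable_hitTime {S : Type*} [MeasurableSpace S] (V : Set S) (hV : MeasurableSet V) :
    Measurable (hitTime V) := by
  classical
  have : hitTime V = fun ω => ⨅ n : ℕ, if 1 ≤ n ∧ ω n ∈ V then (n : ℝ≥0∞) else ⊤ := by
    funext ω; exact hitTime_eq V ω
  rw [this]
  refine Measurable.iInf fun n => Measurable.ite ?_ measurable_const measurable_const
  exact (MeasurableSet.const _).inter (measurable_pi_apply n hV)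

lemma hitTime_le {S : Type*} (V : Set S) (ω : ℕ → S) (n : ℕ) (h1 : 1 ≤ n) (h : ω n ∈ V) :
    hitTime V ω ≤ n := sInf_le ⟨n, rfl, h1, h⟩

lemma hitTime_lt_top_iff {S : Type*} (V : Set S) (ω : ℕ → S) :
    hitTime V ω < ⊤ ↔ ∃ n : ℕ, 1 ≤ n ∧ ω n ∈ V := by
  constructor
  · intro h
    obtain ⟨r, ⟨n, rfl, h1, h2⟩, -⟩ := sInf_lt_iff.1 h
    exact ⟨n, h1, h2⟩
  · rintro ⟨n, h1, h2⟩
    exact (hitTime_le V ω n h1 h2).trans_lt (ENNReal.natCast_lt_top n)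

lemma hitTime_le_shift {S : Type*} (V : Set S) (ω : ℕ → S) (m : ℕ) :
    hitTime V ω ≤ m + hitTime V (fun k => ω (m + k)) := by
  by_cases htop : hitTime V (fun k => ω (m + k)) = ⊤
  · rw [htop]; simp
  · refine ENNReal.le_of_forall_pos_le_add ?_
    intro e he _
    have : hitTime V (fun k => ω (m + k)) < hitTime V (fun k => ω (m + k)) + e :=
      ENNReal.lt_add_right htop (by positivity)
    obtain ⟨r, ⟨n, rfl, h1, h2⟩, hr⟩ := sInf_lt_iff.1 this
    calc hitTime V ω ≤ ((m + n : ℕ) : ℝ≥0∞) := hitTime_le V ω _ (by omega) h2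
      _ = m + n := by push_cast; rfl
      _ ≤ m + (hitTime V (fun k => ω (m + k)) + e) := by gcongr
      _ = _ := by rw [add_assoc]

lemma hitTime_ge_shift {S : Type*} (V : Set S) (ω : ℕ → S) (hω : ω 1 ∉ V) :
    1 + hitTime V (fun k => ω (1 + k)) ≤ hitTime V ω := by
  refine le_sInf ?_
  rintro r ⟨n, rfl, h1, h2⟩
  obtain ⟨k, rfl⟩ := Nat.exists_eq_add_of_le h1
  have hk : 1 ≤ k := by
    rcases Nat.eq_zero_or_pos k with rfl | h
    · exact absurd h2 hω
    · exact h
  push_cast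
  gcongr
  exact hitTime_le V _ k hk h2

lemma one_le_hitTime {S : Type*} (V : Set S) (ω : ℕ → S) : 1 ≤ hitTime V ω := by
  refine le_sInf ?_
  rintro r ⟨n, rfl, h1, h2⟩
  exact_mod_cast h1

/-- indicator-killed truncated hitting time -/
noncomputable def killedHit {S : Type*} (D : Set S) (n : ℕ) (ω : ℕ → S) : ℝ≥0∞ :=
  ({ω : ℕ → S | ω 0 ∉ D}).indicator (fun ω => min (hitTime D ω) n) ω

lemma measurable_killedHit {S : Type*} [MeasurableSpace S] (D : Set S) (hD : MeasurableSet D)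
    (n : ℕ) : Measurable (killedHit D n) := by
  unfold killedHit
  refine Measurable.indicator ((measurable_hitTime D hD).min measurable_const) ?_
  exact (measurable_pi_apply 0 : Measurable fun ω : ℕ → S => ω 0) hD.compl

lemma min_hit_le {S : Type*} (D : Set S) (n m : ℕ) (hm : 1 ≤ m) (ω : ℕ → S) :
    min (hitTime D ω) ((n + 1 : ℕ) : ℝ≥0∞) ≤ m + killedHit D n (fun k => ω (m + k)) := by
  by_cases h : ω m ∈ D
  · exact (min_le_left _ _).trans ((hitTime_le D ω m hm h).trans le_self_add)
  · have : killedHit D n (fun k => ω (m + k)) = min (hitTime D (fun k => ω (m + k))) n := by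
      unfold killedHit
      rw [indicator_of_mem]
      simpa using h
    rw [this, ← min_add_add_left]
    refine min_le_min (hitTime_le_shift D ω m) ?_
    rw [add_comm n 1]
    push_cast
    gcongr
    exact_mod_cast hm

/-- state-dependent Foster bound -/
lemma foster_bound {S : Type*} [MeasurableSpace S] (F : MarkovFamily S) (D : Set S)
    (hD : MeasurableSet D) (Φ : S → ℝ≥0∞) (N : S → ℕ) (hN : ∀ z, 1 ≤ N z)
    (hdrift : ∀ z ∉ D, N z + ∫⁻ ω, Φ (ω (N z)) ∂F.P z ≤ Φ z) (z : S) :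
    ∫⁻ ω, hitTime D ω ∂F.P z ≤ N z + ∫⁻ ω, Φ (ω (N z)) ∂F.P z := by
  have step : ∀ n : ℕ, (∀ w, ∫⁻ ω, killedHit D n ω ∂F.P w ≤ Φ w) → ∀ z,
      ∫⁻ ω, min (hitTime D ω) ((n + 1 : ℕ) : ℝ≥0∞) ∂F.P z
        ≤ N z + ∫⁻ ω, Φ (ω (N z)) ∂F.P z := by
    intro n ih z
    have := F.prob z
    calc ∫⁻ ω, min (hitTime D ω) ((n + 1 : ℕ) : ℝ≥0∞) ∂F.P z
        ≤ ∫⁻ ω, ((N z : ℝ≥0∞) + killedHit D n (fun k => ω (N z + k))) ∂F.P z :=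
          lintegral_mono fun ω => min_hit_le D n (N z) (hN z) ω
      _ = N z + ∫⁻ ω, killedHit D n (fun k => ω (N z + k)) ∂F.P z := by
          rw [lintegral_add_left measurable_const]; simp
      _ = N z + ∫⁻ ω, ∫⁻ ω', killedHit D n ω' ∂F.P (ω (N z)) ∂F.P z := by
          rw [F.lintegral_shift z (N z) _ (measurable_killedHit D hD n)]
      _ ≤ _ := by
          gcongr with ω
          exact ih _
  have key : ∀ n : ℕ, ∀ w, ∫⁻ ω, killedHit D n ω ∂F.P w ≤ Φ w := by
    intro n
    induction n with
    | zero =>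
      intro w
      have : ∀ ω, killedHit D 0 ω = 0 := by
        intro ω; unfold killedHit; simp
      simp [this]
    | succ n ih =>
      intro w
      by_cases hw : w ∈ D
      · have : ∫⁻ ω, killedHit D (n + 1) ω ∂F.P w = 0 := by
          rw [lintegral_eq_zero_iff (measurable_killedHit D hD _)]
          filter_upwards [F.start_ae w D hD hw] with ω hω
          simp [killedHit, hω]
        rw [this]; exact zero_le
      · refine le_trans (lintegral_mono fun ω => ?_) ((step n ih w).trans (hdrift w hw))
        exact indicator_le_self _ _ _
  have hlim : ∀ ω, hitTime D ω = ⨆ n : ℕ, min (hitTime D ω) ((n + 1 : ℕ) : ℝ≥0∞) := by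
    intro ω
    apply le_antisymm
    · by_cases ht : hitTime D ω = ⊤
      · rw [ht]
        simp only [top_le_iff, min_top_left]
        rw [iSup_eq_top]
        intro b hb
        obtain ⟨n, hn⟩ := ENNReal.exists_nat_gt hb.ne
        exact ⟨n, hn.trans_le (by gcongr; omega)⟩
      · obtain ⟨n, hn⟩ := ENNReal.exists_nat_gt ht
        refine le_iSup_of_le n ?_
        rw [min_eq_left]
        exact hn.le.trans (by gcongr; omega)
    · exact iSup_le fun n => min_le_left _ _
  calc ∫⁻ ω, hitTime D ω ∂F.P z
      = ∫⁻ ω, ⨆ n : ℕ, min (hitTime D ω) ((n + 1 : ℕ) : ℝ≥0∞) ∂F.P z := by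
        simp_rw [← hlim]
    _ = ⨆ n : ℕ, ∫⁻ ω, min (hitTime D ω) ((n + 1 : ℕ) : ℝ≥0∞) ∂F.P z := by
        rw [lintegral_iSup (fun n => (measurable_hitTime D hD).min measurable_const)]
        intro i j hij ω
        simp only
        gcongr
    _ ≤ _ := iSup_le fun n => step n (key n) z

lemma measurable_L1fun {X : Type*} [MeasurableSpace X] (XC : MarkovFamily X) (V : Set X)
    (hV : MeasurableSet V) : Measurable (L1fun XC V) := by
  classical
  have : Measurable fun x => ∫⁻ ω, hitTime V ω ∂XC.P x :=
    (Measure.measurable_lintegral (measurable_hitTime V hV)).comp XC.meas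
  have h2 : L1fun XC V = V.indicator (0) + (Vᶜ).indicator
      (fun x => ∫⁻ ω, hitTime V ω ∂XC.P x) := by
    funext x
    by_cases hx : x ∈ V <;> simp [L1fun, hx]
  rw [h2]
  simpa using this.indicator hV.compl

lemma L1fun_step {X : Type*} [MeasurableSpace X] (XC : MarkovFamily X) (V : Set X)
    (hV : MeasurableSet V) (x : X) (hx : x ∉ V) :
    1 + ∫⁻ ω, L1fun XC V (ω 1) ∂XC.P x ≤ L1fun XC V x := by
  classical
  have := XC.prob x
  set G : (ℕ → X) → ℝ≥0∞ := ({ω : ℕ → X | ω 0 ∉ V}).indicator (hitTime V) with hG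
  have hGm : Measurable G :=
    (measurable_hitTime V hV).indicator ((measurable_pi_apply 0 : Measurable fun ω : ℕ → X => ω 0) hV.compl)
  have hL : ∀ w, L1fun XC V w = ∫⁻ ω, G ω ∂XC.P w := by
    intro w
    by_cases hw : w ∈ V
    · simp only [L1fun, hw, if_true]
      symm
      rw [lintegral_eq_zero_iff hGm]
      filter_upwards [XC.start_ae w V hV hw] with ω hω
      simp [hG, hω]
    · simp only [L1fun, hw, if_false]
      refine lintegral_congr_ae ?_
      filter_upwards [XC.start_ae w Vᶜ hV.compl hw] with ω hω
      rw [hG, indicator_of_mem]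
      exact hω
  simp_rw [hL]
  rw [← hL x, ← XC.lintegral_shift x 1 G hGm]
  simp only [L1fun, hx, if_false]
  calc 1 + ∫⁻ ω, G (fun k => ω (1 + k)) ∂XC.P x
      = ∫⁻ ω, (1 + G (fun k => ω (1 + k))) ∂XC.P x := by
        rw [lintegral_add_left measurable_const]; simp
    _ ≤ _ := by
        refine lintegral_mono fun ω => ?_
        by_cases h1 : ω 1 ∈ V
        · have : G (fun k => ω (1 + k)) = 0 := by simp [hG, h1]
          rw [this, add_zero]; exact one_le_hitTime V ω
        · have : G (fun k => ω (1 + k)) = hitTime V (fun k => ω (1 + k)) := by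
            rw [hG, indicator_of_mem]; exact h1
          rw [this]; exact hitTime_ge_shift V ω h1

/-- total variation closeness gives closeness of integrals of bounded functions -/
lemma lintegral_le_of_tv {X : Type*} [MeasurableSpace X] (μ ν : Measure X)
    [IsProbabilityMeasure μ] [IsProbabilityMeasure ν] (g : X → ℝ) (hg : Measurable g) (M δ : ℝ)
    (hM : 0 ≤ M) (hδ : 0 ≤ δ)
    (h0 : ∀ x, 0 ≤ g x) (h1 : ∀ x, g x ≤ M)
    (htv : ∀ B, MeasurableSet B → |(μ B).toReal - (ν B).toReal| ≤ δ) :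
    ∫⁻ x, ENNReal.ofReal (g x) ∂μ ≤ ∫⁻ x, ENNReal.ofReal (g x) ∂ν + ENNReal.ofReal (M * δ) := by
  rw [lintegral_eq_lintegral_meas_lt μ (Eventually.of_forall h0) hg.aemeasurable,
    lintegral_eq_lintegral_meas_lt ν (Eventually.of_forall h0) hg.aemeasurable]
  have hb : ∀ t ∈ Ioi (0 : ℝ), μ {a | t < g a} ≤ ν {a | t < g a}
      + (Ioc 0 M).indicator (fun _ => ENNReal.ofReal δ) t := by
    intro t ht
    by_cases htM : t ≤ M
    · rw [indicator_of_mem (mem_Ioc.2 ⟨ht, htM⟩ : t ∈ Ioc 0 M)]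
      have hm : MeasurableSet {a | t < g a} := measurableSet_lt measurable_const hg
      have := (abs_le.1 (htv _ hm)).2
      rw [← ENNReal.ofReal_toReal (measure_ne_top μ {a | t < g a}),
        ← ENNReal.ofReal_toReal (measure_ne_top ν {a | t < g a}),
        ← ENNReal.ofReal_add ENNReal.toReal_nonneg hδ]
      exact ENNReal.ofReal_le_ofReal (by linarith)
    · have : {a | t < g a} = ∅ := by
        ext a; simp only [mem_ofPred_eq, mem_empty_iff_false, iff_false, not_lt]
        linarith [h1 a]
      rw [this]; simp
  refine (setLIntegral_mono' measurableSet_Ioi hb).trans ?_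
  rw [lintegral_add_right _ (measurable_const.indicator measurableSet_Ioc)]
  gcongr
  refine (setLIntegral_le_lintegral _ _).trans ?_
  rw [lintegral_indicator_const measurableSet_Ioc, Real.volume_Ioc, mul_comm, sub_zero,
    ← ENNReal.ofReal_mul hM]

section drift
variable {X Y : Type*} [MeasurableSpace X] [MeasurableSpace Y]

lemma L2_start (chain : MarkovFamily (X × Y)) (L2 : Y → ℝ) (hL2 : Measurable L2) (w : X × Y) :
    ∀ᵐ ω ∂chain.P w, L2 (ω 0).2 = L2 w.2 := by
  have hs : MeasurableSet {p : X × Y | L2 p.2 = L2 w.2} :=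
    (hL2.comp measurable_snd) (measurableSet_singleton (L2 w.2))
  exact chain.start_ae w _ hs rfl

lemma L2_abs (chain : MarkovFamily (X × Y)) (L2 : Y → ℝ) (U : ℝ) (hB1 : CondB1 chain L2 U)
    (w : X × Y) (t : ℕ) :
    ∫⁻ ω, ENNReal.ofReal |L2 (ω t).2 - L2 w.2| ∂chain.P w ≤ t * ENNReal.ofReal U := by
  obtain ⟨hL2, hpos, hU⟩ := hB1
  have hLm : ∀ t : ℕ, Measurable fun ω : ℕ → X × Y => L2 (ω t).2 := fun t =>
    hL2.comp (measurable_snd.comp (measurable_pi_apply t))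
  induction t with
  | zero =>
    have : ∫⁻ ω, ENNReal.ofReal |L2 (ω 0).2 - L2 w.2| ∂chain.P w = 0 := by
      rw [lintegral_eq_zero_iff (by have := hLm 0; fun_prop)]
      filter_upwards [L2_start chain L2 hL2 w] with ω hω
      simp [hω]
    rw [this]; exact zero_le
  | succ t ih =>
    set g : (ℕ → X × Y) → ℝ≥0∞ := fun ω => ENNReal.ofReal |L2 (ω 1).2 - L2 (ω 0).2| with hg
    have hgm : Measurable g := by
      have h0 := hLm 0
      have h1 := hLm 1
      fun_prop
    have hgi : ∀ v, ∫⁻ ω, g ω ∂chain.P v ≤ ENNReal.ofReal U := by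
      intro v
      refine le_trans (le_of_eq ?_) (hU v.1 v.2)
      refine lintegral_congr_ae ?_
      filter_upwards [L2_start chain L2 hL2 v] with ω hω
      simp [hg, hω]
    have := chain.prob w
    calc ∫⁻ ω, ENNReal.ofReal |L2 (ω (t + 1)).2 - L2 w.2| ∂chain.P w
        ≤ ∫⁻ ω, (ENNReal.ofReal |L2 (ω t).2 - L2 w.2| + g (fun k => ω (t + k))) ∂chain.P w := by
          refine lintegral_mono fun ω => ?_
          simp only [hg, add_zero]
          rw [← ENNReal.ofReal_add (abs_nonneg _) (abs_nonneg _)]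
          apply ENNReal.ofReal_le_ofReal
          have := abs_add_le (L2 (ω t).2 - L2 w.2) (L2 (ω (t + 1)).2 - L2 (ω t).2)
          refine le_trans (le_of_eq ?_) this
          congr 1; ring
      _ = ∫⁻ ω, ENNReal.ofReal |L2 (ω t).2 - L2 w.2| ∂chain.P w
          + ∫⁻ ω, g (fun k => ω (t + k)) ∂chain.P w := by
          rw [lintegral_add_left]
          have := hLm t
          fun_prop
      _ ≤ t * ENNReal.ofReal U + ENNReal.ofReal U := by
          gcongr
          rw [chain.lintegral_shift w t g hgm]
          calc _ ≤ ∫⁻ ω, ENNReal.ofReal U ∂chain.P w := lintegral_mono fun ω => hgi _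
            _ = _ := by simp
      _ = _ := by push_cast; ring

lemma L2_step (chain : MarkovFamily (X × Y)) (π : Measure X) (L2 : Y → ℝ) (U : ℝ) (h : ℝ → ℝ)
    (f : X → ℝ) (ε K : ℝ) (hB1 : CondB1 chain L2 U) (hB2 : CondB2 chain π L2 h f ε)
    (hK : ∀ x, |f x| ≤ K) (w : X × Y) :
    ∫⁻ ω, ENNReal.ofReal (L2 (ω 1).2) ∂chain.P w + ENNReal.ofReal K ≤
      ENNReal.ofReal (L2 w.2) + (ENNReal.ofReal (f w.1 + K) + ENNReal.ofReal (h (L2 w.2))) := by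
  obtain ⟨hL2, hpos, hU⟩ := hB1
  obtain ⟨_, hh0, _, hf, _, hε, _, hd⟩ := hB2
  have := chain.prob w
  have hLm : Measurable fun ω : ℕ → X × Y => L2 (ω 1).2 :=
    hL2.comp (measurable_snd.comp (measurable_pi_apply 1))
  have hInt1 : Integrable (fun ω : ℕ → X × Y => L2 (ω 1).2 - L2 w.2) (chain.P w) := by
    refine ⟨(hLm.sub measurable_const).aestronglyMeasurable, ?_⟩
    rw [hasFiniteIntegral_iff_norm]
    exact (hU w.1 w.2).trans_lt ENNReal.ofReal_lt_top
  have hInt2 : Integrable (fun ω : ℕ → X × Y => L2 (ω 1).2) (chain.P w) := by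
    have := hInt1.add (integrable_const (L2 w.2))
    refine this.congr (Eventually.of_forall fun ω => ?_)
    simp
  have hK0 : 0 ≤ K := (abs_nonneg _).trans (hK w.1)
  have hfK : 0 ≤ f w.1 + K := by have := (abs_le.1 (hK w.1)).1; linarith
  have hle := hd w.1 w.2
  rw [show (w.1, w.2) = w from rfl, integral_sub hInt2 (integrable_const _)] at hle
  simp at hle
  rw [← ofReal_integral_eq_lintegral_ofReal hInt2 (Eventually.of_forall fun ω => hpos _),
    ← ENNReal.ofReal_add (integral_nonneg fun ω => hpos _) hK0, ← ENNReal.ofReal_add hfK (hh0 _),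
    ← ENNReal.ofReal_add (hpos _) (add_nonneg hfK (hh0 _))]
  apply ENNReal.ofReal_le_ofReal
  linarith

lemma L2_sum (chain : MarkovFamily (X × Y)) (π : Measure X) (L2 : Y → ℝ) (U : ℝ) (h : ℝ → ℝ)
    (f : X → ℝ) (ε K : ℝ) (hB1 : CondB1 chain L2 U) (hB2 : CondB2 chain π L2 h f ε)
    (hK : ∀ x, |f x| ≤ K) (w : X × Y) (T : ℕ) :
    ∫⁻ ω, ENNReal.ofReal (L2 (ω T).2) ∂chain.P w + T * ENNReal.ofReal K ≤
      ENNReal.ofReal (L2 w.2) + ∑ t ∈ Finset.range T,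
        (∫⁻ ω, ENNReal.ofReal (f (ω t).1 + K) ∂chain.P w
          + ∫⁻ ω, ENNReal.ofReal (h (L2 (ω t).2)) ∂chain.P w) := by
  have hL2 := hB1.1
  have hhm : Measurable h := hB2.1.measurable
  have hfm : Measurable f := hB2.2.2.2.1
  have := chain.prob w
  induction T with
  | zero =>
    simp only [Nat.cast_zero, zero_mul, add_zero, Finset.range_zero, Finset.sum_empty]
    apply le_of_eq
    calc _ = ∫⁻ ω, ENNReal.ofReal (L2 w.2) ∂chain.P w := by
          refine lintegral_congr_ae ?_
          filter_upwards [L2_start chain L2 hL2 w] with ω hω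
          rw [hω]
      _ = _ := by simp
  | succ T ih =>
    have hm1 : Measurable fun ω : ℕ → X × Y => ENNReal.ofReal (L2 (ω 1).2) := by fun_prop
    have hmT : Measurable fun ω : ℕ → X × Y => ENNReal.ofReal (L2 (ω T).2) := by fun_prop
    have hmf : Measurable fun ω : ℕ → X × Y => ENNReal.ofReal (f (ω T).1 + K) := by fun_prop
    have hstep : ∫⁻ ω, ENNReal.ofReal (L2 (ω (T + 1)).2) ∂chain.P w + ENNReal.ofReal K ≤
        ∫⁻ ω, ENNReal.ofReal (L2 (ω T).2) ∂chain.P w +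
        (∫⁻ ω, ENNReal.ofReal (f (ω T).1 + K) ∂chain.P w
          + ∫⁻ ω, ENNReal.ofReal (h (L2 (ω T).2)) ∂chain.P w) := by
      have e := chain.lintegral_shift w T _ hm1
      rw [e, ← lintegral_add_left hmf, ← lintegral_add_left hmT]
      calc _ = ∫⁻ ω, (∫⁻ ω', ENNReal.ofReal (L2 (ω' 1).2) ∂chain.P (ω T)
                + ENNReal.ofReal K) ∂chain.P w := by
            rw [lintegral_add_right _ measurable_const]; simp
        _ ≤ _ := lintegral_mono fun ω => L2_step chain π L2 U h f ε K hB1 hB2 hK (ω T)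
    rw [Finset.sum_range_succ, ← add_assoc]
    calc _ = (∫⁻ ω, ENNReal.ofReal (L2 (ω (T + 1)).2) ∂chain.P w + ENNReal.ofReal K)
          + T * ENNReal.ofReal K := by push_cast; ring
      _ ≤ (∫⁻ ω, ENNReal.ofReal (L2 (ω T).2) ∂chain.P w +
        (∫⁻ ω, ENNReal.ofReal (f (ω T).1 + K) ∂chain.P w
          + ∫⁻ ω, ENNReal.ofReal (h (L2 (ω T).2)) ∂chain.P w)) + T * ENNReal.ofReal K := by
          gcongr
      _ = (∫⁻ ω, ENNReal.ofReal (L2 (ω T).2) ∂chain.P w + T * ENNReal.ofReal K) +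
        (∫⁻ ω, ENNReal.ofReal (f (ω T).1 + K) ∂chain.P w
          + ∫⁻ ω, ENNReal.ofReal (h (L2 (ω T).2)) ∂chain.P w) := by ring
      _ ≤ _ := by gcongr

lemma h_bound (chain : MarkovFamily (X × Y)) (π : Measure X) (L2 : Y → ℝ) (U : ℝ) (h : ℝ → ℝ)
    (f : X → ℝ) (ε : ℝ) (hB1 : CondB1 chain L2 U) (hB2 : CondB2 chain π L2 h f ε)
    (hU : 0 ≤ U) (N : ℝ) (hN : 0 < N) (w : X × Y) (hw : N < L2 w.2) (t : ℕ) :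
    ∫⁻ ω, ENNReal.ofReal (h (L2 (ω t).2)) ∂chain.P w ≤
      ENNReal.ofReal (h (N / 2) + h 0 * (2 / N) * (t * U)) := by
  have hL2 := hB1.1
  obtain ⟨han, hh0, -⟩ := hB2
  have := chain.prob w
  have hc : 0 ≤ h 0 * (2 / N) := mul_nonneg (hh0 0) (by positivity)
  calc ∫⁻ ω, ENNReal.ofReal (h (L2 (ω t).2)) ∂chain.P w
      ≤ ∫⁻ ω, (ENNReal.ofReal (h (N / 2)) + ENNReal.ofReal (h 0 * (2 / N)) *
          ENNReal.ofReal |L2 (ω t).2 - L2 w.2|) ∂chain.P w := by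
        refine lintegral_mono fun ω => ?_
        simp only
        rw [← ENNReal.ofReal_mul hc, ← ENNReal.ofReal_add (hh0 _) (by positivity)]
        apply ENNReal.ofReal_le_ofReal
        by_cases hl : N / 2 ≤ L2 (ω t).2
        · have := han hl
          have : 0 ≤ h 0 * (2 / N) * |L2 (ω t).2 - L2 w.2| := by positivity
          linarith
        · have h1 : h (L2 (ω t).2) ≤ h 0 := han (hB1.2.1 _)
          have h2 : N / 2 ≤ |L2 (ω t).2 - L2 w.2| := by
            rw [abs_sub_comm]
            refine le_trans ?_ (le_abs_self _)
            linarith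
          have h3 : h 0 * (2 / N) * (N / 2) ≤ h 0 * (2 / N) * |L2 (ω t).2 - L2 w.2| := by gcongr
          have h4 : h 0 * (2 / N) * (N / 2) = h 0 := by field_simp
          linarith [hh0 (N / 2)]
    _ = ENNReal.ofReal (h (N / 2)) + ENNReal.ofReal (h 0 * (2 / N)) *
          ∫⁻ ω, ENNReal.ofReal |L2 (ω t).2 - L2 w.2| ∂chain.P w := by
        rw [lintegral_add_left measurable_const, lintegral_const_mul _ (by fun_prop)]
        simp
    _ ≤ ENNReal.ofReal (h (N / 2)) + ENNReal.ofReal (h 0 * (2 / N)) * (t * ENNReal.ofReal U) := by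
        gcongr
        exact L2_abs chain L2 U hB1 w t
    _ = _ := by
        rw [ENNReal.ofReal_add (hh0 _) (by positivity), ENNReal.ofReal_mul hc,
          ENNReal.ofReal_mul (p := (t : ℝ)) (by positivity), ENNReal.ofReal_natCast]

/-- Combined drift after `T` steps. -/
lemma L2_drift (chain : MarkovFamily (X × Y)) (π : Measure X) (L2 : Y → ℝ) (U : ℝ) (h : ℝ → ℝ)
    (f : X → ℝ) (ε K : ℝ) (hB1 : CondB1 chain L2 U) (hB2 : CondB2 chain π L2 h f ε)
    (hK : ∀ x, |f x| ≤ K) (hKε : ε ≤ K) (w : X × Y) (T T0 : ℕ) (hT : T0 ≤ T)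
    (hTbig : 2 * K * T0 ≤ ε / 4 * T)
    (hf1 : ∀ t ≥ T0, ∫⁻ ω, ENNReal.ofReal (f (ω t).1 + K) ∂chain.P w
      ≤ ENNReal.ofReal (K - 3 / 4 * ε))
    (hh1 : ∀ t < T, ∫⁻ ω, ENNReal.ofReal (h (L2 (ω t).2)) ∂chain.P w ≤ ENNReal.ofReal (ε / 4)) :
    ∫⁻ ω, ENNReal.ofReal (L2 (ω T).2) ∂chain.P w + ENNReal.ofReal (ε / 4 * T) ≤
      ENNReal.ofReal (L2 w.2) := by
  have hε : 0 < ε := hB2.2.2.2.2.2.1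
  have := chain.prob w
  have hsum := L2_sum chain π L2 U h f ε K hB1 hB2 hK w T
  have hK0 : 0 ≤ K := by linarith
  have hf0 : ∀ t : ℕ, ∫⁻ ω, ENNReal.ofReal (f (ω t).1 + K) ∂chain.P w
      ≤ ENNReal.ofReal (2 * K) := by
    intro t
    calc _ ≤ ∫⁻ ω, ENNReal.ofReal (2 * K) ∂chain.P w := by
          refine lintegral_mono fun ω => ENNReal.ofReal_le_ofReal ?_
          have := (abs_le.1 (hK (ω t).1)).2
          linarith
      _ = _ := by simp
  have hterm : ∀ t ∈ Finset.range T, ∫⁻ ω, ENNReal.ofReal (f (ω t).1 + K) ∂chain.P w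
          + ∫⁻ ω, ENNReal.ofReal (h (L2 (ω t).2)) ∂chain.P w ≤
        ENNReal.ofReal ((if t < T0 then 2 * K else 0) + (K - 3 / 4 * ε + ε / 4)) := by
    intro t ht
    have h2 := hh1 t (Finset.mem_range.1 ht)
    split_ifs with hc
    · refine (add_le_add (hf0 t) h2).trans ?_
      rw [← ENNReal.ofReal_add (by positivity) (by positivity)]
      apply ENNReal.ofReal_le_ofReal
      linarith
    · refine (add_le_add (hf1 t (not_lt.1 hc)) h2).trans ?_
      rw [← ENNReal.ofReal_add (by linarith) (by positivity), zero_add]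
  have hs : ∑ t ∈ Finset.range T, (∫⁻ ω, ENNReal.ofReal (f (ω t).1 + K) ∂chain.P w
          + ∫⁻ ω, ENNReal.ofReal (h (L2 (ω t).2)) ∂chain.P w) ≤
        ENNReal.ofReal (T * (K - ε / 4)) := by
    refine (Finset.sum_le_sum hterm).trans ?_
    rw [← ENNReal.ofReal_sum_of_nonneg]
    · apply ENNReal.ofReal_le_ofReal
      rw [Finset.sum_add_distrib, ← Finset.sum_filter]
      have : (Finset.range T).filter (fun t => t < T0) = Finset.range T0 := by
        ext t; simp; omega
      rw [this]
      simp only [Finset.sum_const, Finset.card_range, nsmul_eq_mul]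
      nlinarith
    · intro t _
      split_ifs <;> linarith
  have hfin : ENNReal.ofReal (T * (K - ε / 4)) ≠ ⊤ := ENNReal.ofReal_ne_top
  have h3 := hsum.trans (add_le_add_right hs _)
  have h4 : (T : ℝ≥0∞) * ENNReal.ofReal K = ENNReal.ofReal (ε / 4 * T)
      + ENNReal.ofReal (T * (K - ε / 4)) := by
    rw [← ENNReal.ofReal_add (by positivity) (mul_nonneg (by positivity) (by linarith)),
      ← ENNReal.ofReal_natCast, ← ENNReal.ofReal_mul (by positivity)]
    congr 1; ring
  rw [h4, ← add_assoc] at h3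
  exact (ENNReal.add_le_add_iff_right hfin).1 h3

end drift

/-- **Theorem 1** (Foss–Shneer–Tyurlikov). Under Conditions A and B there is `N0 > 0` such that
the set `D = V × {y : L2 y ≤ N0}` is positive recurrent for the chain `{(X^t, Y^t)}`. -/
theorem theorem1_positive_recurrence
    {X Y : Type*} [MeasurableSpace X] [MeasurableSpace Y]
    [MeasurableSpace.CountablyGenerated X] [MeasurableSpace.CountablyGenerated Y]
    (chain : MarkovFamily (X × Y)) (XC : MarkovFamily X) (V : Set X) (π : Measure X)
    (L2 : Y → ℝ) (U : ℝ) (h : ℝ → ℝ) (f : X → ℝ) (ε : ℝ)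
    (hA : CondA chain XC V π)
    (hB1 : CondB1 chain L2 U)
    (hB2 : CondB2 chain π L2 h f ε) :
    ∃ N0 : ℝ, 0 < N0 ∧ PosRec chain (V ×ˢ {y : Y | L2 y ≤ N0}) := by
  classical
  have hB1o := hB1
  have hB2o := hB2
  obtain ⟨hV, hA0, hVfin, ⟨s0, hs0, hs0V⟩, hπ, hstat, hconv, hunif, hL1⟩ := hA
  obtain ⟨hL2, hpos, hU⟩ := hB1
  obtain ⟨han, hh0, hhlim, hfm, ⟨K0, hK0⟩, hε, hfint, hd⟩ := hB2
  -- make `U` nonnegative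
  obtain ⟨U', hU'0, hB1'⟩ : ∃ U' : ℝ, 0 ≤ U' ∧ CondB1 chain L2 U' :=
    ⟨max U 0, le_max_right _ _, hL2, hpos, fun x y =>
      (hU x y).trans (ENNReal.ofReal_le_ofReal (le_max_left _ _))⟩
  obtain ⟨K, hKε, hK⟩ : ∃ K : ℝ, ε ≤ K ∧ ∀ x, |f x| ≤ K :=
    ⟨max K0 ε, le_max_right _ _, fun x => (hK0 x).trans (le_max_left _ _)⟩
  have hKpos : 0 < K := hε.trans_le hKε
  -- transfer to the X-chain
  have hproj : Measurable (fun (ω : ℕ → X × Y) (n : ℕ) => (ω n).1) := by fun_prop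
  have htrans : ∀ (w : X × Y) (t : ℕ) (g : X → ℝ≥0∞), Measurable g →
      ∫⁻ ω, g (ω t).1 ∂chain.P w = ∫⁻ ω, g (ω t) ∂XC.P w.1 := by
    intro w t g hg
    rw [← hA0 w.1 w.2, lintegral_map (f := fun ω : ℕ → X => g (ω t))
      (hg.comp (measurable_pi_apply t)) hproj]
  -- burn-in time
  obtain ⟨T0, hT0⟩ := hunif (ε / (8 * K)) (by positivity)
  have hf1 : ∀ w : X × Y, w.1 ∈ V → ∀ t ≥ T0, ∫⁻ ω, ENNReal.ofReal (f (ω t).1 + K) ∂chain.P w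
      ≤ ENNReal.ofReal (K - 3 / 4 * ε) := by
    intro w hw t ht
    have hgm : Measurable fun x => ENNReal.ofReal (f x + K) := by fun_prop
    have := XC.prob w.1
    have hmt : Measurable fun ω : ℕ → X => ω t := measurable_pi_apply t
    have : IsProbabilityMeasure (Measure.map (fun ω : ℕ → X => ω t) (XC.P w.1)) :=
      Measure.isProbabilityMeasure_map hmt.aemeasurable
    rw [htrans w t _ hgm, ← lintegral_map (f := fun x => ENNReal.ofReal (f x + K)) hgm hmt]
    refine (lintegral_le_of_tv _ π (fun x => f x + K) (hfm.add measurable_const) (2 * K)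
      (ε / (8 * K)) (by positivity) (by positivity) ?_ ?_ ?_).trans ?_
    · intro x; have := (abs_le.1 (hK x)).1; linarith
    · intro x; have := (abs_le.1 (hK x)).2; linarith
    · intro B hB
      rw [Measure.map_apply hmt hB]
      exact hT0 t ht w.1 hw B hB
    · have hfi : Integrable f π := by
        refine Integrable.of_bound hfm.aestronglyMeasurable K (Eventually.of_forall fun x => ?_)
        rw [Real.norm_eq_abs]; exact hK x
      have hfi2 : Integrable (fun x => f x + K) π := hfi.add (integrable_const K)
      rw [← ofReal_integral_eq_lintegral_ofReal hfi2
        (Eventually.of_forall fun x => by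
          have := (abs_le.1 (hK x)).1
          simp only [Pi.zero_apply]; linarith),
        integral_add hfi (integrable_const K), hfint]
      simp only [integral_const, probReal_univ, smul_eq_mul, one_mul]
      rw [← ENNReal.ofReal_add (by linarith) (by positivity)]
      apply ENNReal.ofReal_le_ofReal
      have : 2 * K * (ε / (8 * K)) = ε / 4 := by field_simp; norm_num
      linarith
  -- the constants
  set a : ℝ := 8 / ε with ha
  have ha0 : 0 < a := by positivity
  set b : ℝ := 1 + a * U' with hb
  have hb0 : 0 < b := by positivity
  obtain ⟨T1, hT1⟩ := hL1 (1 / b) (by positivity)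
  obtain ⟨T, hT0T, hT1T, hT1', hTbig⟩ : ∃ T : ℕ, T0 ≤ T ∧ T1 ≤ T ∧ 1 ≤ T ∧
      2 * K * T0 ≤ ε / 4 * T := by
    obtain ⟨n, hn⟩ := exists_nat_ge (2 * K * T0 / (ε / 4))
    refine ⟨max (max T0 T1) (max 1 n), by omega, by omega, by omega, ?_⟩
    rw [div_le_iff₀ (by positivity)] at hn
    have : (n : ℝ) ≤ (max (max T0 T1) (max 1 n) : ℕ) := by exact_mod_cast (by omega)
    nlinarith
  obtain ⟨N, hN, hNh⟩ : ∃ N : ℝ, 0 < N ∧ h (N / 2) + h 0 * (2 / N) * (T * U') ≤ ε / 4 := by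
    have l1 : Tendsto (fun N : ℝ => h (N / 2) + h 0 * (2 / N) * (T * U')) atTop
        (nhds (0 + h 0 * 0 * (T * U'))) := by
      refine Tendsto.add (hhlim.comp (tendsto_id.atTop_div_const (by norm_num))) ?_
      refine Tendsto.mul_const _ (Tendsto.const_mul _ ?_)
      exact tendsto_const_nhds.div_atTop tendsto_id
    have l2 := l1.eventually (Iio_mem_nhds (show 0 + h 0 * 0 * (T * U') < ε / 4 by
      simp; positivity))
    obtain ⟨N, h1, h2⟩ := (l2.and (eventually_gt_atTop 0)).exists
    exact ⟨N, h2, le_of_lt h1⟩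
  have hh1 : ∀ w : X × Y, N < L2 w.2 → ∀ t < T,
      ∫⁻ ω, ENNReal.ofReal (h (L2 (ω t).2)) ∂chain.P w ≤ ENNReal.ofReal (ε / 4) := by
    intro w hw t ht
    refine (h_bound chain π L2 U' h f ε hB1' hB2o hU'0 N hN w hw t).trans ?_
    apply ENNReal.ofReal_le_ofReal
    refine le_trans ?_ hNh
    have : (t : ℝ) ≤ T := by exact_mod_cast ht.le
    have := hh0 0
    gcongr
  have hL1m := measurable_L1fun XC V hV
  have hgrow : ∀ (w : X × Y) (t : ℕ), ∫⁻ ω, ENNReal.ofReal (L2 (ω t).2) ∂chain.P w ≤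
      ENNReal.ofReal (L2 w.2) + t * ENNReal.ofReal U' := by
    intro w t
    have := chain.prob w
    calc _ ≤ ∫⁻ ω, (ENNReal.ofReal (L2 w.2) + ENNReal.ofReal |L2 (ω t).2 - L2 w.2|) ∂chain.P w := by
          refine lintegral_mono fun ω => ?_
          simp only
          rw [← ENNReal.ofReal_add (hpos _) (abs_nonneg _)]
          apply ENNReal.ofReal_le_ofReal
          linarith [le_abs_self (L2 (ω t).2 - L2 w.2)]
      _ = ENNReal.ofReal (L2 w.2) + ∫⁻ ω, ENNReal.ofReal |L2 (ω t).2 - L2 w.2| ∂chain.P w := by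
          rw [lintegral_add_left measurable_const]; simp
      _ ≤ _ := by
          gcongr
          exact L2_abs chain L2 U' hB1' w t
  set Φ : X × Y → ℝ≥0∞ := fun w =>
    ENNReal.ofReal b * L1fun XC V w.1 + ENNReal.ofReal a * ENNReal.ofReal (L2 w.2) with hΦ
  have hΦint : ∀ (w : X × Y) (t : ℕ), ∫⁻ ω, Φ (ω t) ∂chain.P w =
      ENNReal.ofReal b * ∫⁻ ω, L1fun XC V (ω t) ∂XC.P w.1 +
      ENNReal.ofReal a * ∫⁻ ω, ENNReal.ofReal (L2 (ω t).2) ∂chain.P w := by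
    intro w t
    simp only [hΦ]
    rw [lintegral_add_left (by fun_prop), lintegral_const_mul _ (by fun_prop),
      lintegral_const_mul _ (by fun_prop), htrans w t _ hL1m]
  have hbE : ENNReal.ofReal b = 1 + ENNReal.ofReal a * ENNReal.ofReal U' := by
    rw [hb, ENNReal.ofReal_add zero_le_one (by positivity), ENNReal.ofReal_mul ha0.le,
      ENNReal.ofReal_one]
  have hL1T : ∀ x ∈ V, ENNReal.ofReal b * ∫⁻ ω, L1fun XC V (ω T) ∂XC.P x ≤ T := by
    intro x hx
    calc _ ≤ ENNReal.ofReal b * ENNReal.ofReal (1 / b * T) := by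
          gcongr
          exact hT1 T hT1T x hx
      _ = ENNReal.ofReal T := by
          rw [← ENNReal.ofReal_mul hb0.le]
          congr 1; field_simp
      _ = T := ENNReal.ofReal_natCast T
  set D : Set (X × Y) := V ×ˢ {y : Y | L2 y ≤ N} with hD
  have hDm : MeasurableSet D := hV.prod (measurableSet_le hL2 measurable_const)
  have hDiff : ∀ w : X × Y, w ∈ D ↔ w.1 ∈ V ∧ L2 w.2 ≤ N := fun w => by simp [hD]
  have hfoster := foster_bound chain D hDm Φ (fun w => if w.1 ∈ V then T else 1)
    (by intro z; split_ifs <;> omega) (by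
      intro z hz
      rw [hΦint]
      by_cases hzV : z.1 ∈ V
      · have hzN : N < L2 z.2 := by
          by_contra hcon
          exact hz ((hDiff z).2 ⟨hzV, not_lt.1 hcon⟩)
        have hdr := L2_drift chain π L2 U' h f ε K hB1' hB2o hK hKε z T T0 hT0T hTbig
          (hf1 z hzV) (hh1 z hzN)
        have hz0 : L1fun XC V z.1 = 0 := by simp [L1fun, hzV]
        simp only [hzV, if_true, hΦ, hz0, mul_zero, zero_add]
        have e2 : (T : ℝ≥0∞) + T = ENNReal.ofReal a * ENNReal.ofReal (ε / 4 * T) := by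
          rw [← ENNReal.ofReal_mul ha0.le, ← ENNReal.ofReal_natCast,
            ← ENNReal.ofReal_add (by positivity) (by positivity)]
          congr 1
          rw [ha]; field_simp; norm_num
        calc _ ≤ (T : ℝ≥0∞) + (T + ENNReal.ofReal a *
                ∫⁻ ω, ENNReal.ofReal (L2 (ω T).2) ∂chain.P z) := by
              gcongr
              exact hL1T _ hzV
          _ = ENNReal.ofReal a * (∫⁻ ω, ENNReal.ofReal (L2 (ω T).2) ∂chain.P z
                + ENNReal.ofReal (ε / 4 * T)) := by
              rw [← add_assoc, e2, mul_add, add_comm]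
          _ ≤ _ := by gcongr
      · have h1 := L1fun_step XC V hV z.1 hzV
        have h2 := hgrow z 1
        simp only [hzV, if_false, hΦ, Nat.cast_one, one_mul] at h2 ⊢
        calc _ ≤ 1 + (ENNReal.ofReal b * ∫⁻ ω, L1fun XC V (ω 1) ∂XC.P z.1 +
                ENNReal.ofReal a * (ENNReal.ofReal (L2 z.2) + ENNReal.ofReal U')) := by gcongr
          _ = ENNReal.ofReal b * (1 + ∫⁻ ω, L1fun XC V (ω 1) ∂XC.P z.1) +
                ENNReal.ofReal a * ENNReal.ofReal (L2 z.2) := by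
              rw [hbE]; ring
          _ ≤ _ := by gcongr)
  have hbound : ∀ z : X × Y, z.1 ∈ V → ∫⁻ ω, hitTime D ω ∂chain.P z ≤
      T + (T + ENNReal.ofReal a * (ENNReal.ofReal (L2 z.2) + T * ENNReal.ofReal U')) := by
    intro z hz
    refine (hfoster z).trans ?_
    rw [hΦint]
    simp only [hz, if_true]
    gcongr
    · exact hL1T _ hz
    · exact hgrow z T
  have hTtop : (T : ℝ≥0∞) < ⊤ := ENNReal.natCast_lt_top T
  have hfinC : ∀ r : ℝ, (T : ℝ≥0∞) + (T + ENNReal.ofReal a *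
      (ENNReal.ofReal r + T * ENNReal.ofReal U')) < ⊤ := by
    intro r
    have := ENNReal.mul_lt_top hTtop (ENNReal.ofReal_lt_top (r := U'))
    refine ENNReal.add_lt_top.2 ⟨hTtop, ENNReal.add_lt_top.2 ⟨hTtop, ?_⟩⟩
    exact ENNReal.mul_lt_top ENNReal.ofReal_lt_top
      (ENNReal.add_lt_top.2 ⟨ENNReal.ofReal_lt_top, this⟩)
  refine ⟨N, hN, ?_, ?_⟩
  · -- almost sure finiteness
    intro z
    have := chain.prob z
    set A : Set (ℕ → X × Y) := {ω | (ω 0).1 ∈ V} ∩ {ω | hitTime D ω = ⊤} with hAdef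
    have hAV : MeasurableSet {ω : ℕ → X × Y | (ω 0).1 ∈ V} :=
      (measurable_fst.comp (measurable_pi_apply 0) :
        Measurable fun ω : ℕ → X × Y => (ω 0).1) hV
    have hAtop : MeasurableSet {ω : ℕ → X × Y | hitTime D ω = ⊤} :=
      (measurable_hitTime D hDm) (measurableSet_singleton ⊤)
    have hAm : MeasurableSet A := hAV.inter hAtop
    have hA0' : ∀ w, chain.P w A = 0 := by
      intro w
      by_cases hw : w.1 ∈ V
      · have hlt := ae_lt_top (measurable_hitTime D hDm)
          ((hbound w hw).trans_lt (hfinC _)).ne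
        refine measure_mono_null inter_subset_right ?_
        refine measure_mono_null (fun ω hω => ?_) (ae_iff.1 hlt)
        exact fun hcon => hcon.ne hω
      · have := chain.start_ae w (Prod.fst ⁻¹' Vᶜ) (measurable_fst hV.compl) hw
        refine measure_mono_null inter_subset_left ?_
        refine measure_mono_null (fun ω hω => ?_) (ae_iff.1 this)
        exact fun hcon => hcon hω
    have hshift : ∀ n : ℕ, ∀ᵐ ω ∂chain.P z, ¬ ((fun k => ω (n + k)) ∈ A) := by
      intro n
      have hm := chain.markov z n univ MeasurableSet.univ A hAm
      rw [univ_inter, setLIntegral_univ] at hm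
      simp only [hA0', lintegral_zero] at hm
      rw [ae_iff]
      simpa only [not_not] using hm
    have hXhit : ∀ᵐ ω ∂chain.P z, hitTime V (fun n => (ω n).1) < ⊤ := by
      have hm : MeasurableSet {ω : ℕ → X | hitTime V ω < ⊤} :=
        measurableSet_lt (measurable_hitTime V hV) measurable_const
      have h1 := hVfin z.1
      rw [← hA0 z.1 z.2, Measure.map_apply hproj hm] at h1
      exact (prob_compl_eq_zero_iff (hproj hm)).2 h1
    have hfinal : ∀ᵐ ω ∂chain.P z, hitTime D ω < ⊤ := by
      filter_upwards [hXhit, ae_all_iff.2 hshift] with ω h1 h2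
      obtain ⟨n, hn1, hn2⟩ := (hitTime_lt_top_iff _ _).1 h1
      have h3 := h2 n
      have h4 : hitTime D (fun k => ω (n + k)) ≠ ⊤ := by
        intro hcon
        exact h3 ⟨hn2, hcon⟩
      exact (hitTime_le_shift D ω n).trans_lt
        (ENNReal.add_lt_top.2 ⟨ENNReal.natCast_lt_top n, lt_top_iff_ne_top.2 h4⟩)
    have hm : MeasurableSet {ω : ℕ → X × Y | hitTime D ω < ⊤} :=
      measurableSet_lt (measurable_hitTime D hDm) measurable_const
    exact (prob_compl_eq_zero_iff hm).1 hfinal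
  · refine ⟨_, hfinC N, ?_⟩
    intro z hz
    obtain ⟨hz1, hz2⟩ := (hDiff z).1 hz
    refine (hbound z hz1).trans ?_
    gcongr
end

section
/- Assume Conditions A and Condition B1. Assume further that, uniformly in x ∈ 𝒳, the conditional distribution P_{x,y}(L2(Y^1) − L2(y) ∈ ·) converges weakly and in L1 (i.e. together with convergence of first absolute moments) to a limiting distribution H_x(·) as L2(y) → ∞, and that ∫_𝒳 ∫_ℝ u H_x(du) π(dx) < 0. Then the Markov chain {(X^t,Y^t)} is positive recurrent: there exists N0 > 0 such that the set D := V × {y : L2(y) ≤ N0} is positive recurrent. -/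
open MeasureTheory ProbabilityTheory Filter Set
open scoped ENNReal

section Helpers
set_option linter.unusedSectionVars false
variable {S : Type*} [MeasurableSpace S]

lemma mf_shift_measurable (n : ℕ) : Measurable (fun (ω : ℕ → S) (k : ℕ) => ω (n + k)) :=
  measurable_pi_lambda _ fun _ => measurable_pi_apply _

lemma mf_markov (F : MarkovFamily S) (z : S) (n : ℕ) (G : (ℕ → S) → ℝ≥0∞) (hG : Measurable G) :
    ∫⁻ ω, G (fun k => ω (n + k)) ∂F.P z = ∫⁻ ω, ∫⁻ ω', G ω' ∂F.P (ω n) ∂F.P z := by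
  have hm : Measurable (fun ω : ℕ → S => F.P (ω n)) := F.meas.comp (measurable_pi_apply n)
  have h1 : Measure.map (fun (ω : ℕ → S) (k : ℕ) => ω (n + k)) (F.P z)
      = (F.P z).bind (fun ω => F.P (ω n)) := by
    ext A hA
    rw [Measure.map_apply (mf_shift_measurable n) hA, Measure.bind_apply hA hm.aemeasurable]
    have := F.markov z n univ MeasurableSet.univ A hA
    rw [univ_inter, setLIntegral_univ] at this
    exact this
  rw [← lintegral_map hG (mf_shift_measurable n), h1,
    Measure.lintegral_bind hm.aemeasurable hG.aemeasurable]

lemma mf_start (F : MarkovFamily S) (z : S) (A : Set S) (hA : MeasurableSet A) (hz : z ∈ A) :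
    ∀ᵐ ω ∂F.P z, ω 0 ∈ A := by
  have := F.prob z
  have hm : MeasurableSet {ω : ℕ → S | ω 0 ∈ A} := measurable_pi_apply 0 hA
  refine (prob_compl_eq_zero_iff hm).2 ?_
  refine le_antisymm prob_le_one ?_
  rw [← F.start z]
  refine measure_mono ?_
  intro ω hω
  simp only [mem_ofPred_eq] at hω ⊢
  rwa [hω]

lemma mf_start_eq {R : Type*} [MeasurableSpace R] [MeasurableSingletonClass R]
    (F : MarkovFamily S) (z : S) (q : S → R) (hq : Measurable q) :
    ∀ᵐ ω ∂F.P z, q (ω 0) = q z :=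
  mf_start F z (q ⁻¹' {q z}) (hq (measurableSet_singleton _)) rfl

lemma hit_le (D : Set S) (ω : ℕ → S) (n : ℕ) (hn : 1 ≤ n) (h : ω n ∈ D) : hitTime D ω ≤ n :=
  sInf_le ⟨n, rfl, hn, h⟩

lemma hit_le_shift (D : Set S) (ω : ℕ → S) (m : ℕ) :
    hitTime D ω ≤ m + hitTime D (fun k => ω (m + k)) := by
  unfold hitTime
  rw [ENNReal.add_sInf]
  refine le_iInf₂ ?_
  rintro r ⟨n, rfl, hn, h⟩
  refine sInf_le ⟨m + n, by push_cast; rfl, by omega, h⟩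

lemma hit_one_le (D : Set S) (ω : ℕ → S) : 1 ≤ hitTime D ω := by
  refine le_sInf ?_
  rintro r ⟨n, rfl, hn, h⟩
  exact_mod_cast hn

lemma hit_ge_shift (D : Set S) (ω : ℕ → S) (h1 : ω 1 ∉ D) :
    1 + hitTime D (fun k => ω (1 + k)) ≤ hitTime D ω := by
  refine le_sInf ?_
  rintro r ⟨n, rfl, hn, h⟩
  obtain ⟨m, rfl⟩ : ∃ m, n = 1 + m := ⟨n - 1, by omega⟩
  have hm : 1 ≤ m := by
    rcases Nat.eq_zero_or_pos m with rfl | h'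
    · exact absurd h h1
    · exact h'
  push_cast
  gcongr
  exact hit_le D _ m hm h

lemma hit_measurable (D : Set S) (hD : MeasurableSet D) : Measurable (hitTime D : (ℕ → S) → ℝ≥0∞) := by
  classical
  have : (hitTime D : (ℕ → S) → ℝ≥0∞)
      = fun ω => ⨅ n : ℕ, if 1 ≤ n ∧ ω n ∈ D then (n : ℝ≥0∞) else ⊤ := by
    funext ω
    apply le_antisymm
    · refine le_iInf fun n => ?_
      split_ifs with h
      · exact hit_le D ω n h.1 h.2
      · exact le_top
    · refine le_sInf ?_
      rintro r ⟨n, rfl, hn, h⟩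
      refine (iInf_le _ n).trans ?_
      rw [if_pos ⟨hn, h⟩]
  rw [this]
  refine Measurable.iInf fun n => ?_
  refine Measurable.ite ?_ measurable_const measurable_const
  exact (MeasurableSet.const (1 ≤ n)).inter (measurable_pi_apply (X := fun _ : ℕ => S) n hD)

/-- one-step / multi-step recursion for truncated hitting times -/
lemma hit_rec (F : MarkovFamily S) (D : Set S) (hD : MeasurableSet D) (z : S) (m : ℕ) (hm : 1 ≤ m)
    (k : ℕ) (W : S → ℝ≥0∞)
    (hW : ∀ z, z ∉ D → ∫⁻ ω, min (hitTime D ω) k ∂F.P z ≤ W z) :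
    ∫⁻ ω, min (hitTime D ω) (k + 1 : ℕ) ∂F.P z ≤ m + ∫⁻ ω, W (ω m) ∂F.P z := by
  classical
  have := F.prob z
  set G : (ℕ → S) → ℝ≥0∞ := fun ω => if ω 0 ∈ D then 0 else min (hitTime D ω) k with hGdef
  have hG : Measurable G := by
    refine Measurable.ite (measurable_pi_apply 0 hD) measurable_const ?_
    exact (hit_measurable D hD).min measurable_const
  have h1 : ∀ ω : ℕ → S, min (hitTime D ω) (k + 1 : ℕ) ≤ m + G (fun j => ω (m + j)) := by
    intro ω
    simp only [hGdef, add_zero]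
    split_ifs with h
    · simpa using (min_le_left _ _).trans (hit_le D ω m hm h)
    · rcases le_total (hitTime D (fun j => ω (m + j))) k with h' | h'
      · rw [min_eq_left h']
        exact (min_le_left _ _).trans (hit_le_shift D ω m)
      · rw [min_eq_right h']
        refine (min_le_right _ _).trans ?_
        norm_cast
        omega
  calc ∫⁻ ω, min (hitTime D ω) (k + 1 : ℕ) ∂F.P z
      ≤ ∫⁻ ω, (m + G (fun j => ω (m + j))) ∂F.P z := lintegral_mono h1
    _ = m + ∫⁻ ω, G (fun j => ω (m + j)) ∂F.P z := by
        rw [lintegral_add_left measurable_const]; simp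
    _ = m + ∫⁻ ω, ∫⁻ ω', G ω' ∂F.P (ω m) ∂F.P z := by rw [mf_markov F z m G hG]
    _ ≤ _ := by
        gcongr with ω
        by_cases h : ω m ∈ D
        · have : ∫⁻ ω', G ω' ∂F.P (ω m) = 0 := by
            rw [lintegral_eq_zero_iff hG]
            filter_upwards [mf_start F (ω m) D hD h] with ω' h'
            simp [hGdef, h']
          rw [this]; exact zero_le
        · refine le_trans (lintegral_mono fun ω' => ?_) (hW _ h)
          simp only [hGdef]
          split_ifs
          · exact zero_le
          · exact le_rfl

lemma hit_iSup (F : MarkovFamily S) (D : Set S) (hD : MeasurableSet D) (z : S) (C : ℝ≥0∞)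
    (h : ∀ k : ℕ, ∫⁻ ω, min (hitTime D ω) k ∂F.P z ≤ C) : ∫⁻ ω, hitTime D ω ∂F.P z ≤ C := by
  have e : ∀ ω : ℕ → S, hitTime D ω = ⨆ k : ℕ, min (hitTime D ω) (k : ℝ≥0∞) := by
    intro ω
    rw [← inf_iSup_eq, ENNReal.iSup_natCast, inf_top_eq]
  rw [lintegral_congr e]
  rw [lintegral_iSup]
  · exact iSup_le h
  · exact fun k => (hit_measurable D hD).min measurable_const
  · intro a b hab ω
    exact min_le_min le_rfl (by exact_mod_cast hab)

/-- If `D` is hit a.s. from every point of `E` and `E` is hit a.s. then `D` is hit a.s. -/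
lemma hit_finite (F : MarkovFamily S) (D E : Set S) (hD : MeasurableSet D) (hE : MeasurableSet E)
    (h1 : ∀ z ∈ E, ∀ᵐ ω ∂F.P z, hitTime D ω < ⊤) (z : S)
    (h2 : ∀ᵐ ω ∂F.P z, hitTime E ω < ⊤) : ∀ᵐ ω ∂F.P z, hitTime D ω < ⊤ := by
  classical
  set G : (ℕ → S) → ℝ≥0∞ := fun ω => if ω 0 ∈ E ∧ hitTime D ω = ⊤ then 1 else 0 with hGdef
  have hG : Measurable G := by
    refine Measurable.ite ?_ measurable_const measurable_const
    exact (measurable_pi_apply (X := fun _ : ℕ => S) 0 hE).inter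
      (hit_measurable D hD (measurableSet_singleton ⊤))
  have h3 : ∀ n : ℕ, ∀ᵐ ω ∂F.P z, G (fun k => ω (n + k)) = 0 := by
    intro n
    have : ∫⁻ ω, G (fun k => ω (n + k)) ∂F.P z = 0 := by
      rw [mf_markov F z n G hG]
      refine (lintegral_congr fun ω => ?_).trans lintegral_zero
      rw [lintegral_eq_zero_iff hG]
      by_cases h : ω n ∈ E
      · filter_upwards [h1 _ h] with ω' h'
        simp [hGdef, h'.ne]
      · filter_upwards [mf_start F (ω n) Eᶜ hE.compl h] with ω' h'
        have : ω' 0 ∉ E := h'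
        simp [hGdef, this]
    exact (lintegral_eq_zero_iff (hG.comp (mf_shift_measurable n))).1 this
  filter_upwards [h2, ae_all_iff.2 h3] with ω hω hall
  unfold hitTime at hω
  rw [sInf_lt_iff] at hω
  obtain ⟨r, ⟨n, rfl, hn, hmem⟩, -⟩ := hω
  have := hall n
  simp only [hGdef, add_zero, ite_eq_right_iff, one_ne_zero, imp_false, not_and] at this
  have h4 := this hmem
  refine lt_of_le_of_lt (hit_le_shift D ω n) ?_
  rw [ENNReal.add_lt_top]
  exact ⟨ENNReal.natCast_lt_top n, lt_top_iff_ne_top.2 h4⟩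

/-- total variation comparison of integrals of bounded functions -/
lemma tv_bound (μ ν : Measure S) [IsProbabilityMeasure μ] [IsProbabilityMeasure ν]
    (g : S → ℝ) (hg : Measurable g) (M : ℝ) (h0 : ∀ x, 0 ≤ g x) (hM : ∀ x, g x ≤ M) (hM0 : 0 ≤ M)
    (ε : ℝ) (hε : 0 ≤ ε)
    (h : ∀ B, MeasurableSet B → |(μ B).toReal - (ν B).toReal| ≤ ε) :
    ∫⁻ x, ENNReal.ofReal (g x) ∂μ ≤ ENNReal.ofReal (∫ x, g x ∂ν + M * ε) := by
  have hint : Integrable g ν := by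
    refine Integrable.of_bound hg.aestronglyMeasurable M (Eventually.of_forall fun x => ?_)
    rw [Real.norm_eq_abs, abs_of_nonneg (h0 x)]; exact hM x
  rw [ENNReal.ofReal_add (integral_nonneg h0) (by positivity),
    ofReal_integral_eq_lintegral_ofReal hint (Eventually.of_forall h0),
    lintegral_eq_lintegral_meas_lt μ (Eventually.of_forall h0) hg.aemeasurable,
    lintegral_eq_lintegral_meas_lt ν (Eventually.of_forall h0) hg.aemeasurable]
  have hb : ∀ t : ℝ, μ {a | t < g a} ≤ ν {a | t < g a} + (Iio M).indicator (fun _ => ENNReal.ofReal ε) t := by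
    intro t
    by_cases ht : t < M
    · have hB : MeasurableSet {a | t < g a} := measurableSet_lt measurable_const hg
      have := (abs_le.1 (h _ hB)).2
      rw [indicator_of_mem (by exact ht)]
      rw [← ENNReal.ofReal_toReal (measure_ne_top μ {a | t < g a}),
        ← ENNReal.ofReal_toReal (measure_ne_top ν {a | t < g a}),
        ← ENNReal.ofReal_add ENNReal.toReal_nonneg hε]
      exact ENNReal.ofReal_le_ofReal (by linarith)
    · have : {a | t < g a} = ∅ := by
        ext a; simp only [mem_ofPred_eq, mem_empty_iff_false, iff_false, not_lt]
        exact (hM a).trans (not_lt.1 ht)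
      simp [this]
  refine (lintegral_mono hb).trans ?_
  rw [lintegral_add_right _ (measurable_const.indicator measurableSet_Iio)]
  gcongr
  rw [lintegral_indicator_const measurableSet_Iio, Measure.restrict_apply measurableSet_Iio,
    inter_comm, Ioi_inter_Iio, Real.volume_Ioo, sub_zero, mul_comm, ENNReal.ofReal_mul hM0]

end Helpers

section TwoComp
variable {X Y : Type*} [MeasurableSpace X] [MeasurableSpace Y]

lemma lint_P_measurable {S : Type*} [MeasurableSpace S] (F : MarkovFamily S)
    (G : (ℕ → S) → ℝ≥0∞) (hG : Measurable G) : Measurable fun z => ∫⁻ ω, G ω ∂F.P z :=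
  (Measure.measurable_lintegral hG).comp F.meas

lemma L1_measurable (XC : MarkovFamily X) (V : Set X) (hV : MeasurableSet V) :
    Measurable (L1fun XC V) := by
  classical
  unfold L1fun
  exact Measurable.ite hV measurable_const (lint_P_measurable XC _ (hit_measurable V hV))

lemma L1_drift (XC : MarkovFamily X) (V : Set X) (hV : MeasurableSet V) (x : X) (hx : x ∉ V) :
    1 + ∫⁻ ω, L1fun XC V (ω 1) ∂XC.P x ≤ L1fun XC V x := by
  classical
  have := XC.prob x
  set G : (ℕ → X) → ℝ≥0∞ := fun ω => if ω 0 ∈ V then 0 else hitTime V ω with hGdef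
  have hG : Measurable G :=
    Measurable.ite (measurable_pi_apply 0 hV) measurable_const (hit_measurable V hV)
  have h1 : ∀ ω : ℕ → X, 1 + G (fun j => ω (1 + j)) ≤ hitTime V ω := by
    intro ω
    simp only [hGdef, add_zero]
    split_ifs with h
    · simpa using hit_one_le V ω
    · exact hit_ge_shift V ω h
  have h2 : L1fun XC V x = ∫⁻ ω, hitTime V ω ∂XC.P x := by rw [L1fun, if_neg hx]
  rw [h2]
  refine le_trans ?_ (lintegral_mono h1)
  rw [lintegral_add_left measurable_const, mf_markov XC x 1 G hG]
  simp only [lintegral_const, measure_univ, mul_one]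
  gcongr with ω
  by_cases h : ω 1 ∈ V
  · simp [L1fun, h]
  · rw [L1fun, if_neg h]
    refine lintegral_mono_ae ?_
    filter_upwards [mf_start XC (ω 1) Vᶜ hV.compl h] with ω' h'
    have : ω' 0 ∉ V := h'
    simp [hGdef, this]

lemma proj_measurable : Measurable (fun (ω : ℕ → X × Y) (n : ℕ) => (ω n).1) :=
  measurable_pi_lambda _ fun n => (measurable_pi_apply n).fst

lemma chain_X (chain : MarkovFamily (X × Y)) (XC : MarkovFamily X)
    (h : ∀ x y, Measure.map (fun (ω : ℕ → X × Y) (n : ℕ) => (ω n).1) (chain.P (x, y)) = XC.P x)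
    (q : X → ℝ≥0∞) (hq : Measurable q) (t : ℕ) (z : X × Y) :
    ∫⁻ ω, q (ω t).1 ∂chain.P z = ∫⁻ ω, q (ω t) ∂XC.P z.1 := by
  have hm : Measurable fun ω : ℕ → X => q (ω t) := hq.comp (measurable_pi_apply t)
  rw [← h z.1 z.2, lintegral_map hm proj_measurable]

lemma L2t_measurable (L2 : Y → ℝ) (hL2 : Measurable L2) (t : ℕ) :
    Measurable fun ω : ℕ → X × Y => L2 (ω t).2 :=
  hL2.comp (measurable_pi_apply t).snd

lemma abs_incr (chain : MarkovFamily (X × Y)) (L2 : Y → ℝ) (U : ℝ) (hU : 0 ≤ U)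
    (hB1 : CondB1 chain L2 U) (z : X × Y) (t : ℕ) :
    ∫⁻ ω, ENNReal.ofReal |L2 (ω t).2 - L2 z.2| ∂chain.P z ≤ ENNReal.ofReal (t * U) := by
  obtain ⟨hL2, h0, hB⟩ := hB1
  have := chain.prob z
  induction t with
  | zero =>
    have : ∀ᵐ ω ∂chain.P z, L2 (ω 0).2 = L2 z.2 :=
      mf_start_eq chain z (fun w => L2 w.2) (hL2.comp measurable_snd)
    have h' : ∫⁻ ω, ENNReal.ofReal |L2 (ω 0).2 - L2 z.2| ∂chain.P z = 0 := by
      rw [lintegral_congr_ae (g := fun _ => 0) ?_, lintegral_zero]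
      filter_upwards [this] with ω h
      simp [h]
    rw [h']; exact zero_le
  | succ t ih =>
    set G : (ℕ → X × Y) → ℝ≥0∞ := fun ω => ENNReal.ofReal |L2 (ω 1).2 - L2 (ω 0).2| with hGdef
    have hG : Measurable G :=
      (((L2t_measurable L2 hL2 1).sub (L2t_measurable L2 hL2 0)).abs).ennreal_ofReal
    have h1 : ∫⁻ ω, ENNReal.ofReal |L2 (ω (t + 1)).2 - L2 (ω t).2| ∂chain.P z ≤ ENNReal.ofReal U := by
      have e := mf_markov chain z t G hG
      simp only [hGdef, add_zero] at e
      rw [e]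
      calc _ ≤ ∫⁻ ω, ENNReal.ofReal U ∂chain.P z := by
            refine lintegral_mono fun ω => ?_
            refine le_trans (le_of_eq ?_) (hB (ω t).1 (ω t).2)
            refine lintegral_congr_ae ?_
            filter_upwards [mf_start_eq chain (ω t) (fun w => L2 w.2) (hL2.comp measurable_snd)]
              with ω' h'
            simp only [h']
        _ = _ := by simp
    have h2 : ∀ ω : ℕ → X × Y, ENNReal.ofReal |L2 (ω (t + 1)).2 - L2 z.2| ≤
        ENNReal.ofReal |L2 (ω (t + 1)).2 - L2 (ω t).2| + ENNReal.ofReal |L2 (ω t).2 - L2 z.2| := by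
      intro ω
      rw [← ENNReal.ofReal_add (abs_nonneg _) (abs_nonneg _)]
      exact ENNReal.ofReal_le_ofReal (abs_sub_le _ _ _)
    calc _ ≤ _ := lintegral_mono h2
      _ = _ := lintegral_add_left
        (((L2t_measurable L2 hL2 (t + 1)).sub (L2t_measurable L2 hL2 t)).abs).ennreal_ofReal _
      _ ≤ ENNReal.ofReal U + ENNReal.ofReal (t * U) := add_le_add h1 ih
      _ = _ := by
        rw [← ENNReal.ofReal_add hU (by positivity)]; congr 1; push_cast; ring

lemma L2_upper (chain : MarkovFamily (X × Y)) (L2 : Y → ℝ) (U : ℝ) (hU : 0 ≤ U)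
    (hB1 : CondB1 chain L2 U) (z : X × Y) (t : ℕ) :
    ∫⁻ ω, ENNReal.ofReal (L2 (ω t).2) ∂chain.P z
      ≤ ENNReal.ofReal (L2 z.2) + ENNReal.ofReal (t * U) := by
  have := chain.prob z
  have h : ∀ ω : ℕ → X × Y, ENNReal.ofReal (L2 (ω t).2) ≤
      ENNReal.ofReal (L2 z.2) + ENNReal.ofReal |L2 (ω t).2 - L2 z.2| := by
    intro ω
    rw [← ENNReal.ofReal_add (hB1.2.1 _) (abs_nonneg _)]
    exact ENNReal.ofReal_le_ofReal (by linarith [le_abs_self (L2 (ω t).2 - L2 z.2)])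
  refine (lintegral_mono h).trans ?_
  rw [lintegral_add_left measurable_const]
  simp only [lintegral_const, measure_univ, mul_one]
  gcongr
  exact abs_incr chain L2 U hU hB1 z t

lemma prob_low (chain : MarkovFamily (X × Y)) (L2 : Y → ℝ) (U : ℝ) (hU : 0 ≤ U)
    (hB1 : CondB1 chain L2 U) (z : X × Y) (t : ℕ) (N1 : ℝ) (hz : N1 < L2 z.2) :
    chain.P z {ω | L2 (ω t).2 < N1} ≤ ENNReal.ofReal (t * U / (L2 z.2 - N1)) := by
  have hp : 0 < L2 z.2 - N1 := by linarith
  have hm : Measurable fun ω : ℕ → X × Y => ENNReal.ofReal |L2 (ω t).2 - L2 z.2| :=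
    (((L2t_measurable L2 hB1.1 t).sub measurable_const).abs).ennreal_ofReal
  rw [ENNReal.ofReal_div_of_pos hp]
  refine le_trans (measure_mono ?_) ((meas_ge_le_lintegral_div hm.aemeasurable
    (ε := ENNReal.ofReal (L2 z.2 - N1)) (by simpa using hp) ENNReal.ofReal_ne_top).trans ?_)
  · intro ω hω
    have hω' : L2 (ω t).2 < N1 := hω
    refine ENNReal.ofReal_le_ofReal ?_
    rw [abs_sub_comm]
    linarith [le_abs_self (L2 z.2 - L2 (ω t).2)]
  · gcongr
    exact abs_incr chain L2 U hU hB1 z t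

lemma multi_drift (chain : MarkovFamily (X × Y)) (L2 : Y → ℝ) (U : ℝ) (hU : 0 ≤ U)
    (hB1 : CondB1 chain L2 U) (g : X → ℝ) (hg : Measurable g) (K η N1 : ℝ)
    (hstep : ∀ x y, N1 ≤ L2 y → ∫⁻ ω, ENNReal.ofReal (L2 (ω 1).2) ∂chain.P (x, y)
      + ENNReal.ofReal K ≤ ENNReal.ofReal (L2 y) + ENNReal.ofReal (g x) + ENNReal.ofReal η)
    (z : X × Y) (t : ℕ) :
    ∫⁻ ω, ENNReal.ofReal (L2 (ω t).2) ∂chain.P z + t * ENNReal.ofReal K ≤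
      ENNReal.ofReal (L2 z.2) + ∑ s ∈ Finset.range t, (∫⁻ ω, ENNReal.ofReal (g (ω s).1) ∂chain.P z
        + ENNReal.ofReal η
        + (ENNReal.ofReal U + ENNReal.ofReal K) * chain.P z {ω | L2 (ω s).2 < N1}) := by
  classical
  have := chain.prob z
  obtain ⟨hL2, h0, hB⟩ := hB1
  have hall : ∀ w : X × Y, ∫⁻ ω, ENNReal.ofReal (L2 (ω 1).2) ∂chain.P w
      + ENNReal.ofReal K ≤ ENNReal.ofReal (L2 w.2) + (ENNReal.ofReal (g w.1) + ENNReal.ofReal η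
      + {w : X × Y | L2 w.2 < N1}.indicator (fun _ => ENNReal.ofReal U + ENNReal.ofReal K) w) := by
    intro w
    by_cases hw : L2 w.2 < N1
    · rw [indicator_of_mem (by exact hw)]
      have := L2_upper chain L2 U hU ⟨hL2, h0, hB⟩ w 1
      simp only [Nat.cast_one, one_mul] at this
      calc _ ≤ ENNReal.ofReal (L2 w.2) + ENNReal.ofReal U + ENNReal.ofReal K := by gcongr
        _ ≤ _ := by
          rw [add_assoc]
          exact add_le_add le_rfl le_add_self
    · rw [indicator_of_notMem (by exact hw), add_zero, ← add_assoc]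
      exact hstep w.1 w.2 (not_lt.1 hw)
  induction t with
  | zero =>
    have := L2_upper chain L2 U hU ⟨hL2, h0, hB⟩ z 0
    simpa using this
  | succ t ih =>
    have e := mf_markov chain z t (fun ω => ENNReal.ofReal (L2 (ω 1).2))
      (L2t_measurable L2 hL2 1).ennreal_ofReal
    rw [e, Finset.sum_range_succ, ← add_assoc]
    refine le_trans ?_ (add_le_add_left ih _)
    have hlow : MeasurableSet {w : X × Y | L2 w.2 < N1} :=
      measurableSet_lt (hL2.comp measurable_snd) measurable_const
    have hgm : Measurable fun ω : ℕ → X × Y => ENNReal.ofReal (g (ω t).1) :=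
      (hg.comp (measurable_pi_apply t).fst).ennreal_ofReal
    have hgm2 : Measurable fun ω : ℕ → X × Y => ENNReal.ofReal (g (ω t).1) + ENNReal.ofReal η :=
      hgm.add measurable_const
    have h3 : ∫⁻ ω, ∫⁻ ω', ENNReal.ofReal (L2 (ω' 1).2) ∂chain.P (ω t) ∂chain.P z
        + ENNReal.ofReal K ≤ ∫⁻ ω, ENNReal.ofReal (L2 (ω t).2) ∂chain.P z
        + (∫⁻ ω, ENNReal.ofReal (g (ω t).1) ∂chain.P z + ENNReal.ofReal η
        + (ENNReal.ofReal U + ENNReal.ofReal K) * chain.P z {ω | L2 (ω t).2 < N1}) := by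
      calc _ = ∫⁻ ω, (∫⁻ ω', ENNReal.ofReal (L2 (ω' 1).2) ∂chain.P (ω t) + ENNReal.ofReal K)
            ∂chain.P z := by
            rw [lintegral_add_right _ measurable_const]; simp
        _ ≤ _ := lintegral_mono fun ω => hall (ω t)
        _ = _ := by
          rw [lintegral_add_left (L2t_measurable L2 hL2 t).ennreal_ofReal,
            lintegral_add_left hgm2, lintegral_add_left hgm]
          congr 2
          · simp
          · have : ∀ ω : ℕ → X × Y, {w : X × Y | L2 w.2 < N1}.indicator
                (fun _ => ENNReal.ofReal U + ENNReal.ofReal K) (ω t)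
                = {ω : ℕ → X × Y | L2 (ω t).2 < N1}.indicator
                (fun _ => ENNReal.ofReal U + ENNReal.ofReal K) ω := by
              intro ω; simp [indicator]
            simp_rw [this]
            rw [lintegral_indicator_const]
            exact measurableSet_lt (L2t_measurable L2 hL2 t) measurable_const
    calc _ = (∫⁻ ω, ∫⁻ ω', ENNReal.ofReal (L2 (ω' 1).2) ∂chain.P (ω t) ∂chain.P z
        + ENNReal.ofReal K) + t * ENNReal.ofReal K := by push_cast; ring
      _ ≤ _ := add_le_add_left h3 _
      _ = _ := by ring
end TwoComp

section DriftData

lemma drift_data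
    {X Y : Type*} [MeasurableSpace X] [MeasurableSpace Y]
    (chain : MarkovFamily (X × Y)) (π : Measure X) [IsProbabilityMeasure π]
    (L2 : Y → ℝ) (U : ℝ) (hU : 0 ≤ U)
    (hB1 : CondB1 chain L2 U)
    (H : X → Measure ℝ)
    (hHint : ∀ x, Integrable (fun u : ℝ => u) (H x))
    (hweak : ∀ g : ℝ → ℝ, Continuous g → (∃ C : ℝ, ∀ u, |g u| ≤ C) →
      ∀ ε : ℝ, 0 < ε → ∃ N : ℝ, ∀ y : Y, N ≤ L2 y → ∀ x : X,
        |∫ ω, g (L2 (ω 1).2 - L2 y) ∂ chain.P (x, y) - ∫ u, g u ∂ H x| ≤ ε)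
    (hL1 : ∀ ε : ℝ, 0 < ε → ∃ N : ℝ, ∀ y : Y, N ≤ L2 y → ∀ x : X,
        |∫ ω, |L2 (ω 1).2 - L2 y| ∂ chain.P (x, y) - ∫ u, |u| ∂ H x| ≤ ε)
    (hneg : ∫ x, (∫ u, u ∂ H x) ∂π < 0) :
    ∃ (g : X → ℝ) (K M : ℝ), Measurable g ∧ (∀ x, 0 ≤ g x) ∧ (∀ x, g x ≤ M) ∧ 0 ≤ M ∧ 0 ≤ K ∧
      ∫ x, g x ∂π < K ∧ ∀ η : ℝ, 0 < η → ∃ N1 : ℝ, ∀ x y, N1 ≤ L2 y →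
        ∫⁻ ω, ENNReal.ofReal (L2 (ω 1).2) ∂chain.P (x, y)
      + ENNReal.ofReal K ≤ ENNReal.ofReal (L2 y) + ENNReal.ofReal (g x) + ENNReal.ofReal η := by
  obtain ⟨hL2, h0, hB⟩ := hB1
  by_cases hunb : ∀ N : ℝ, ∃ y, N ≤ L2 y
  swap
  · push Not at hunb
    obtain ⟨N, hN⟩ := hunb
    refine ⟨fun _ => 0, 1, 0, measurable_const, fun _ => le_rfl, fun _ => le_rfl, le_rfl,
      zero_le_one, by simp, fun η _ => ⟨N, fun x y h => ?_⟩⟩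
    exact absurd h (not_le.2 (hN y))
  choose yn hyn using fun n : ℕ => hunb n
  have hdm : ∀ y, Measurable fun ω : ℕ → X × Y => L2 (ω 1).2 - L2 y := fun y =>
    (L2t_measurable L2 hL2 1).sub measurable_const
  have hdint : ∀ x y, Integrable (fun ω : ℕ → X × Y => L2 (ω 1).2 - L2 y) (chain.P (x, y)) := by
    intro x y
    refine ⟨(hdm y).aestronglyMeasurable, ?_⟩
    rw [hasFiniteIntegral_iff_norm]
    exact lt_of_le_of_lt (hB x y) ENNReal.ofReal_lt_top
  have hdabs : ∀ x y, ∫ ω, |L2 (ω 1).2 - L2 y| ∂ chain.P (x, y) ≤ U := by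
    intro x y
    have := hB x y
    rw [← ofReal_integral_eq_lintegral_ofReal (hdint x y).abs
      (Eventually.of_forall fun _ => abs_nonneg _)] at this
    exact (ENNReal.ofReal_le_ofReal_iff hU).1 this
  have hHabs : ∀ x, ∫ u, |u| ∂ H x ≤ U + 1 := by
    intro x
    obtain ⟨N, hN⟩ := hL1 1 one_pos
    obtain ⟨y, hy⟩ := hunb N
    have h1 := (abs_le.1 (hN y hy x)).1
    linarith [hdabs x y]
  set r : ℕ → ℝ → ℝ := fun M u => 2 * max (-(M : ℝ)) (min u 0) with hr
  have hrc : ∀ M, Continuous (r M) := fun M => by simp only [hr]; fun_prop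
  have hrb : ∀ M u, |r M u| ≤ 2 * M := by
    intro M u
    have hM : (0 : ℝ) ≤ M := Nat.cast_nonneg M
    simp only [hr]
    rw [abs_le]
    constructor
    · linarith [le_max_left (-(M : ℝ)) (min u 0)]
    · have : max (-(M : ℝ)) (min u 0) ≤ 0 := max_le (by linarith) (min_le_right _ _)
      linarith
  have hrb2 : ∀ M u, |r M u| ≤ 2 * |u| := by
    intro M u
    have hM : (0 : ℝ) ≤ M := Nat.cast_nonneg M
    have h1 : max (-(M : ℝ)) (min u 0) ≤ 0 := max_le (by linarith) (min_le_right _ _)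
    have h2 : -|u| ≤ min u 0 := le_min (neg_abs_le u) (by simp)
    have h3 := le_max_right (-(M : ℝ)) (min u 0)
    simp only [hr]
    rw [abs_le]
    constructor <;> linarith [abs_nonneg u]
  have hrl : ∀ M u, u ≤ |u| + r M u := by
    intro M u
    have h3 := le_max_right (-(M : ℝ)) (min u 0)
    simp only [hr]
    rcases le_total 0 u with h | h
    · rw [min_eq_right h] at *
      rw [abs_of_nonneg h]; linarith
    · rw [min_eq_left h] at *
      rw [abs_of_nonpos h]; linarith
  have hrint : ∀ M x, Integrable (r M) (H x) := fun M x =>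
    ((hHint x).abs.const_mul 2).mono' (hrc M).aestronglyMeasurable
      (Eventually.of_forall fun u => by rw [Real.norm_eq_abs]; exact hrb2 M u)
  set f : ℕ → X → ℝ := fun M x => ∫ u, |u| ∂ H x + ∫ u, r M u ∂ H x with hf
  set K : ℝ := 3 * (U + 1) with hK
  have hfb : ∀ M x, |f M x| ≤ K := by
    intro M x
    have h1 : |∫ u, r M u ∂ H x| ≤ 2 * ∫ u, |u| ∂ H x := by
      rw [← integral_const_mul, ← Real.norm_eq_abs]
      exact norm_integral_le_of_norm_le ((hHint x).abs.const_mul 2)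
        (Eventually.of_forall fun u => by rw [Real.norm_eq_abs]; exact hrb2 M u)
    have h2 : 0 ≤ ∫ u, |u| ∂ H x := integral_nonneg fun u => abs_nonneg u
    have h3 := hHabs x
    simp only [hf]
    refine (abs_add_le _ _).trans ?_
    rw [abs_of_nonneg h2]
    linarith
  have hPint : ∀ (q : ℝ → ℝ) (_ : Measurable q) (y : Y),
      Measurable fun x => ∫ ω, q (L2 (ω 1).2 - L2 y) ∂chain.P (x, y) := by
    intro q hq y
    let κ : Kernel X (ℕ → X × Y) :=
      ⟨fun x => chain.P (x, y), chain.meas.comp (measurable_id.prodMk measurable_const)⟩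
    have hs : StronglyMeasurable (fun ω : ℕ → X × Y => q (L2 (ω 1).2 - L2 y)) :=
      (hq.comp (hdm y)).stronglyMeasurable
    exact (StronglyMeasurable.integral_kernel (κ := κ) hs).measurable
  have hfm : ∀ M, Measurable (f M) := by
    intro M
    refine measurable_of_tendsto_metrizable (f := fun (n : ℕ) x =>
      ∫ ω, |L2 (ω 1).2 - L2 (yn n)| ∂chain.P (x, yn n)
      + ∫ ω, r M (L2 (ω 1).2 - L2 (yn n)) ∂chain.P (x, yn n)) ?_ ?_
    · intro n
      exact (hPint (fun u => |u|) measurable_id.abs (yn n)).add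
        (hPint (r M) (hrc M).measurable (yn n))
    · rw [tendsto_pi_nhds]
      intro x
      refine Tendsto.add ?_ ?_
      · rw [Metric.tendsto_atTop]
        intro ε hε
        obtain ⟨N, hN⟩ := hL1 (ε / 2) (by positivity)
        obtain ⟨n0, hn0⟩ := exists_nat_ge N
        refine ⟨n0, fun n hn => ?_⟩
        have hle : (n0 : ℝ) ≤ n := by exact_mod_cast hn
        rw [Real.dist_eq]
        exact lt_of_le_of_lt (hN (yn n) ((hn0.trans hle).trans (hyn n)) x) (by linarith)
      · rw [Metric.tendsto_atTop]
        intro ε hε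
        obtain ⟨N, hN⟩ := hweak (r M) (hrc M) ⟨_, hrb M⟩ (ε / 2) (by positivity)
        obtain ⟨n0, hn0⟩ := exists_nat_ge N
        refine ⟨n0, fun n hn => ?_⟩
        have hle : (n0 : ℝ) ≤ n := by exact_mod_cast hn
        rw [Real.dist_eq]
        exact lt_of_le_of_lt (hN (yn n) ((hn0.trans hle).trans (hyn n)) x) (by linarith)
  have hflim : ∀ x, Tendsto (fun M => f M x) atTop (nhds (∫ u, u ∂ H x)) := by
    intro x
    have e : ∫ u, u ∂ H x = ∫ u, |u| ∂ H x + ∫ u, 2 * min u 0 ∂ H x := by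
      rw [← integral_add (hHint x).abs]
      · congr 1; ext u
        rcases le_total 0 u with h | h
        · rw [min_eq_right h, abs_of_nonneg h]; ring
        · rw [min_eq_left h, abs_of_nonpos h]; ring
      · exact ((hHint x).inf (integrable_zero _ _ _)).const_mul 2
    rw [e]
    refine tendsto_const_nhds.add ?_
    refine tendsto_integral_of_dominated_convergence (fun u => 2 * |u|)
      (fun M => (hrc M).aestronglyMeasurable) ((hHint x).abs.const_mul 2)
      (fun M => Eventually.of_forall fun u => by rw [Real.norm_eq_abs]; exact hrb2 M u)
      (Eventually.of_forall fun u => ?_)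
    refine tendsto_const_nhds.congr' ?_
    obtain ⟨n0, hn0⟩ := exists_nat_ge |u|
    filter_upwards [eventually_ge_atTop n0] with n hn
    have hle : (n0 : ℝ) ≤ n := by exact_mod_cast hn
    simp only [hr]
    rw [max_eq_right]
    refine le_min ?_ ?_
    · linarith [neg_abs_le u]
    · linarith [abs_nonneg u]
  have hlim : Tendsto (fun M => ∫ x, f M x ∂π) atTop (nhds (∫ x, (∫ u, u ∂ H x) ∂π)) :=
    tendsto_integral_of_dominated_convergence (fun _ => K)
      (fun M => (hfm M).aestronglyMeasurable) (integrable_const K)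
      (fun M => Eventually.of_forall fun x => by rw [Real.norm_eq_abs]; exact hfb M x)
      (Eventually.of_forall hflim)
  obtain ⟨M, hM⟩ := (hlim.eventually_lt_const hneg).exists
  have hK0 : 0 ≤ K := by positivity
  have hfi : Integrable (f M) π := Integrable.of_bound (hfm M).aestronglyMeasurable K
    (Eventually.of_forall fun x => by rw [Real.norm_eq_abs]; exact hfb M x)
  refine ⟨fun x => f M x + K, K, 2 * K, (hfm M).add measurable_const, fun x => ?_, fun x => ?_,
    by positivity, hK0, ?_, fun η hη => ?_⟩
  · linarith [(abs_le.1 (hfb M x)).1]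
  · linarith [(abs_le.1 (hfb M x)).2]
  · rw [integral_add hfi (integrable_const K)]
    simp
    exact hM
  obtain ⟨N, hN⟩ := hL1 (η / 2) (by positivity)
  obtain ⟨N', hN'⟩ := hweak (r M) (hrc M) ⟨_, hrb M⟩ (η / 2) (by positivity)
  refine ⟨max N N', fun x y hy => ?_⟩
  have := chain.prob (x, y)
  have h1 := (abs_le.1 (hN y ((le_max_left _ _).trans hy) x)).2
  have h2 := (abs_le.1 (hN' y ((le_max_right _ _).trans hy) x)).2
  have hrdi : Integrable (fun ω : ℕ → X × Y => r M (L2 (ω 1).2 - L2 y)) (chain.P (x, y)) :=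
    Integrable.of_bound ((hrc M).measurable.comp (hdm y)).aestronglyMeasurable (2 * M)
      (Eventually.of_forall fun ω => by rw [Real.norm_eq_abs]; exact hrb M _)
  have h3 : ∫ ω, (L2 (ω 1).2 - L2 y) ∂chain.P (x, y) ≤ f M x + η := by
    calc _ ≤ ∫ ω, (|L2 (ω 1).2 - L2 y| + r M (L2 (ω 1).2 - L2 y)) ∂chain.P (x, y) :=
          integral_mono (hdint x y) ((hdint x y).abs.add hrdi) fun ω => hrl M _
      _ = _ := integral_add (hdint x y).abs hrdi
      _ ≤ _ := by simp only [hf]; linarith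
  have hLi : Integrable (fun ω : ℕ → X × Y => L2 (ω 1).2) (chain.P (x, y)) := by
    have := (hdint x y).add (integrable_const (L2 y))
    refine this.congr (Eventually.of_forall fun ω => ?_)
    simp
  have h4 : ∫ ω, (L2 (ω 1).2 - L2 y) ∂chain.P (x, y) = ∫ ω, L2 (ω 1).2 ∂chain.P (x, y) - L2 y := by
    rw [integral_sub hLi (integrable_const _)]
    simp
  have hg0 : 0 ≤ f M x + K := by linarith [(abs_le.1 (hfb M x)).1]
  rw [← ofReal_integral_eq_lintegral_ofReal hLi (Eventually.of_forall fun _ => h0 _),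
    ← ENNReal.ofReal_add (integral_nonneg fun _ => h0 _) hK0,
    ← ENNReal.ofReal_add (h0 y) hg0, ← ENNReal.ofReal_add (add_nonneg (h0 y) hg0) hη.le]
  refine ENNReal.ofReal_le_ofReal ?_
  linarith

end DriftData

/-- **Corollary 1** (Foss–Shneer–Tyurlikov). Assume Conditions A and B1. If, uniformly in
`x`, the conditional law of the increment `L2(Y^1) - L2(y)` started from `(x,y)` converges
weakly and in `L¹` (i.e. together with first absolute moments) to a limit law `H x` as
`L2 y → ∞`, and the averaged mean `∫∫ u H_x(du) π(dx)` is negative, then the chain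
`{(X^t, Y^t)}` is positive recurrent: some set `V × {y : L2 y ≤ N0}` is positive recurrent. -/
theorem corollary1_positive_recurrence
    {X Y : Type*} [MeasurableSpace X] [MeasurableSpace Y]
    [MeasurableSpace.CountablyGenerated X] [MeasurableSpace.CountablyGenerated Y]
    (chain : MarkovFamily (X × Y)) (XC : MarkovFamily X) (V : Set X) (π : Measure X)
    (L2 : Y → ℝ) (U : ℝ)
    (hA : CondA chain XC V π)
    (hB1 : CondB1 chain L2 U)
    (H : X → Measure ℝ)
    (hHprob : ∀ x, IsProbabilityMeasure (H x))
    (hHint : ∀ x, Integrable (fun u : ℝ => u) (H x))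
    (hHmeas : Measurable fun x => ∫ u, u ∂ H x)
    -- weak convergence of the increment law to `H x`, uniformly in `x`, as `L2 y → ∞`
    (hweak : ∀ g : ℝ → ℝ, Continuous g → (∃ C : ℝ, ∀ u, |g u| ≤ C) →
      ∀ ε : ℝ, 0 < ε → ∃ N : ℝ, ∀ y : Y, N ≤ L2 y → ∀ x : X,
        |∫ ω, g (L2 (ω 1).2 - L2 y) ∂ chain.P (x, y) - ∫ u, g u ∂ H x| ≤ ε)
    -- convergence of the first absolute moments, uniformly in `x`, as `L2 y → ∞`
    (hL1 : ∀ ε : ℝ, 0 < ε → ∃ N : ℝ, ∀ y : Y, N ≤ L2 y → ∀ x : X,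
        |∫ ω, |L2 (ω 1).2 - L2 y| ∂ chain.P (x, y) - ∫ u, |u| ∂ H x| ≤ ε)
    -- the averaged limiting mean drift is negative
    (hneg : ∫ x, (∫ u, u ∂ H x) ∂π < 0) :
    ∃ N0 : ℝ, 0 < N0 ∧ PosRec chain (V ×ˢ {y : Y | L2 y ≤ N0}) := by
  classical
  obtain ⟨hV, hA0, hVfin, -, hπ, -, -, hTV, hL1c⟩ := hA
  -- reduce to `U ≥ 0`
  obtain ⟨U, hU, hB1⟩ : ∃ U' : ℝ, 0 ≤ U' ∧ CondB1 chain L2 U' :=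
    ⟨max U 0, le_max_right _ _, hB1.1, hB1.2.1, fun x y =>
      (hB1.2.2 x y).trans (ENNReal.ofReal_le_ofReal (le_max_left _ _))⟩
  obtain ⟨g, K, M, hg, hg0, hgM, hM0, hK0, hgK, hstep⟩ :=
    drift_data chain π L2 U hU hB1 H hHint hweak hL1 hneg
  have hL2 := hB1.1
  have h0 := hB1.2.1
  set Ig : ℝ := ∫ x, g x ∂π with hIg
  have hIg0 : 0 ≤ Ig := integral_nonneg hg0
  obtain ⟨κ, hκ⟩ : ∃ κ : ℝ, κ = K - Ig := ⟨_, rfl⟩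
  have hκ0 : 0 < κ := by rw [hκ]; linarith
  -- convergence of `E g(X_t)`
  obtain ⟨T0, hT0⟩ := hTV (κ / 8 / (M + 1)) (by positivity)
  have hgE : ∀ t ≥ T0, ∀ x ∈ V, ∫⁻ ω, ENNReal.ofReal (g (ω t)) ∂XC.P x
      ≤ ENNReal.ofReal (Ig + κ / 8) := by
    intro t ht x hx
    have := XC.prob x
    have hmt : Measurable fun ω : ℕ → X => ω t := measurable_pi_apply t
    have hpm : IsProbabilityMeasure (Measure.map (fun ω : ℕ → X => ω t) (XC.P x)) :=
      Measure.isProbabilityMeasure_map hmt.aemeasurable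
    have h1 := tv_bound (Measure.map (fun ω : ℕ → X => ω t) (XC.P x)) π g hg M hg0 hgM hM0
      (κ / 8 / (M + 1)) (by positivity) (by
        intro B hB
        rw [Measure.map_apply hmt hB]
        exact hT0 t ht x hx B hB)
    rw [lintegral_map hg.ennreal_ofReal hmt] at h1
    refine h1.trans (ENNReal.ofReal_le_ofReal ?_)
    have : M * (κ / 8 / (M + 1)) ≤ κ / 8 := by
      rw [mul_div_assoc', div_le_iff₀ (by positivity)]
      nlinarith
    linarith
  obtain ⟨c, hc⟩ : ∃ c : ℝ, c = 8 / κ := ⟨_, rfl⟩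
  have hc0 : 0 < c := by rw [hc]; positivity
  have hKc0 : 0 < 1 + c * U := by positivity
  obtain ⟨T1, hT1⟩ := hL1c (1 / (1 + c * U)) (by positivity)
  obtain ⟨T2, hT2⟩ := exists_nat_ge (T0 * M * 4 / κ)
  obtain ⟨T, hTT0, hTT1, hTT2, hTT3⟩ : ∃ T : ℕ, T0 ≤ T ∧ T1 ≤ T ∧ T2 ≤ T ∧ 1 ≤ T :=
    ⟨T0 + T1 + T2 + 1, by omega, by omega, by omega, by omega⟩
  have hT0M : T0 * M ≤ κ * T / 4 := by
    have h1 : (T2 : ℝ) ≤ T := by exact_mod_cast hTT2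
    have h2 := hT2.trans h1
    rw [div_le_iff₀ hκ0] at h2
    linarith
  obtain ⟨N1, hN1⟩ := hstep (κ / 8) (by positivity)
  obtain ⟨N0, hN0⟩ : ∃ N0 : ℝ, N0 = |N1| + 1 + 4 * (U + K) * T * U / κ := ⟨_, rfl⟩
  have hN0pos : 0 < N0 := by rw [hN0]; positivity
  have hN0N1 : 1 + 4 * (U + K) * T * U / κ ≤ N0 - N1 := by
    rw [hN0]; linarith [le_abs_self N1]
  -- the `T`-step drift
  have hdrift : ∀ z : X × Y, z.1 ∈ V → N0 < L2 z.2 →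
      ∫⁻ ω, ENNReal.ofReal (L2 (ω T).2) ∂chain.P z + ENNReal.ofReal (T * κ / 4)
        ≤ ENNReal.ofReal (L2 z.2) := by
    intro z hz1 hz2
    have := chain.prob z
    have h1 := multi_drift chain L2 U hU hB1 g hg K (κ / 8) N1 hN1 z T
    have hquo : 0 ≤ 4 * (U + K) * T * U / κ := by positivity
    have hpos : 0 < L2 z.2 - N1 := by linarith
    have hterm : ∀ s ∈ Finset.range T, (∫⁻ ω, ENNReal.ofReal (g (ω s).1) ∂chain.P z
        + ENNReal.ofReal (κ / 8)
        + (ENNReal.ofReal U + ENNReal.ofReal K) * chain.P z {ω | L2 (ω s).2 < N1})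
        ≤ ENNReal.ofReal ((Ig + κ / 2) + if s < T0 then M else 0) := by
      intro s hs
      have hsT : (s : ℝ) ≤ T := by exact_mod_cast (Finset.mem_range.1 hs).le
      have ha : ∫⁻ ω, ENNReal.ofReal (g (ω s).1) ∂chain.P z
          ≤ ENNReal.ofReal ((Ig + κ / 8) + if s < T0 then M else 0) := by
        rw [chain_X chain XC hA0 (fun x => ENNReal.ofReal (g x)) hg.ennreal_ofReal s z]
        split_ifs with h
        · have := XC.prob z.1
          calc _ ≤ ∫⁻ ω, ENNReal.ofReal M ∂XC.P z.1 :=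
                lintegral_mono fun ω => ENNReal.ofReal_le_ofReal (hgM _)
            _ = ENNReal.ofReal M := by simp
            _ ≤ _ := ENNReal.ofReal_le_ofReal (by linarith)
        · rw [add_zero]
          exact hgE s (not_lt.1 h) z.1 hz1
      have hb : (ENNReal.ofReal U + ENNReal.ofReal K) * chain.P z {ω | L2 (ω s).2 < N1}
          ≤ ENNReal.ofReal (κ / 4) := by
        calc _ ≤ ENNReal.ofReal (U + K) * ENNReal.ofReal (s * U / (L2 z.2 - N1)) := by
              rw [ENNReal.ofReal_add hU hK0]
              gcongr
              exact prob_low chain L2 U hU hB1 z s N1 (by linarith)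
          _ = ENNReal.ofReal ((U + K) * (s * U / (L2 z.2 - N1))) :=
              (ENNReal.ofReal_mul (by positivity)).symm
          _ ≤ _ := by
              refine ENNReal.ofReal_le_ofReal ?_
              rw [mul_div_assoc', div_le_iff₀ hpos]
              have e1 : 4 * (U + K) * T * U / κ ≤ L2 z.2 - N1 := by linarith
              rw [div_le_iff₀ hκ0] at e1
              have e2 : (U + K) * (s * U) ≤ (U + K) * (T * U) := by gcongr
              linarith
      have hif : (0 : ℝ) ≤ if s < T0 then M else 0 := by split_ifs <;> simp [hM0]
      calc _ ≤ ENNReal.ofReal ((Ig + κ / 8) + if s < T0 then M else 0) + ENNReal.ofReal (κ / 8)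
            + ENNReal.ofReal (κ / 4) := by gcongr
        _ = _ := by
          rw [← ENNReal.ofReal_add (by positivity) (by positivity),
            ← ENNReal.ofReal_add (by positivity) (by positivity)]
          congr 1; ring
    have hsum : ∑ s ∈ Finset.range T, (∫⁻ ω, ENNReal.ofReal (g (ω s).1) ∂chain.P z
        + ENNReal.ofReal (κ / 8)
        + (ENNReal.ofReal U + ENNReal.ofReal K) * chain.P z {ω | L2 (ω s).2 < N1})
        ≤ ENNReal.ofReal (T * K - T * κ / 4) := by
      refine (Finset.sum_le_sum hterm).trans ?_
      rw [← ENNReal.ofReal_sum_of_nonneg]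
      · refine ENNReal.ofReal_le_ofReal ?_
        rw [Finset.sum_add_distrib, Finset.sum_const, Finset.card_range, nsmul_eq_mul,
          ← Finset.sum_filter, Finset.sum_const, nsmul_eq_mul]
        have hcard : ((Finset.filter (fun s => s < T0) (Finset.range T)).card : ℝ) ≤ T0 := by
          have : (Finset.filter (fun s => s < T0) (Finset.range T)).card ≤ (Finset.range T0).card := by
            refine Finset.card_le_card fun s hs => ?_
            simp only [Finset.mem_filter, Finset.mem_range] at hs ⊢
            exact hs.2
          rw [Finset.card_range] at this
          exact_mod_cast this
        have := mul_le_mul_of_nonneg_right hcard hM0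
        have hIgK : Ig = K - κ := by linarith
        rw [hIgK]
        linarith
      · intro s _
        split_ifs <;> positivity
    have hnn : 0 ≤ T * K - T * κ / 4 := by
      have : T * K - T * κ / 4 = T * (Ig + 3 * κ / 4) := by rw [hκ]; ring
      rw [this]; positivity
    have h2 : (T : ℝ≥0∞) * ENNReal.ofReal K
        = ENNReal.ofReal (T * κ / 4) + ENNReal.ofReal (T * K - T * κ / 4) := by
      rw [← ENNReal.ofReal_add (by positivity) hnn, ← ENNReal.ofReal_natCast,
        ← ENNReal.ofReal_mul (by positivity)]
      congr 1; ring
    rw [h2, ← add_assoc] at h1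
    exact (ENNReal.add_le_add_iff_right ENNReal.ofReal_ne_top).1
      (h1.trans (add_le_add le_rfl hsum))
  -- the Lyapunov function
  have hφm : Measurable (L1fun XC V) := L1_measurable XC V hV
  obtain ⟨W, hW⟩ : ∃ W : X × Y → ℝ≥0∞, W = fun z => ENNReal.ofReal (1 + c * U) * L1fun XC V z.1
      + ENNReal.ofReal c * ENNReal.ofReal (L2 z.2) := ⟨_, rfl⟩
  have hWint : ∀ (z : X × Y) (t : ℕ), ∫⁻ ω, W (ω t) ∂chain.P z
      = ENNReal.ofReal (1 + c * U) * ∫⁻ ω, L1fun XC V (ω t) ∂XC.P z.1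
        + ENNReal.ofReal c * ∫⁻ ω, ENNReal.ofReal (L2 (ω t).2) ∂chain.P z := by
    intro z t
    have m1 : Measurable fun ω : ℕ → X × Y => L1fun XC V (ω t).1 :=
      hφm.comp (measurable_pi_apply t).fst
    have m2 : Measurable fun ω : ℕ → X × Y => ENNReal.ofReal (L2 (ω t).2) :=
      (L2t_measurable L2 hL2 t).ennreal_ofReal
    simp only [hW]
    rw [lintegral_add_left (m1.const_mul _), lintegral_const_mul _ m1, lintegral_const_mul _ m2,
      chain_X chain XC hA0 (L1fun XC V) hφm t z]
  have hWT : ∀ z : X × Y, z.1 ∈ V → ∫⁻ ω, W (ω T) ∂chain.P z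
      ≤ ENNReal.ofReal T + ENNReal.ofReal c * ∫⁻ ω, ENNReal.ofReal (L2 (ω T).2) ∂chain.P z := by
    intro z hz
    rw [hWint]
    gcongr
    calc _ ≤ ENNReal.ofReal (1 + c * U) * ENNReal.ofReal (1 / (1 + c * U) * T) := by
          gcongr
          exact hT1 T hTT1 z.1 hz
      _ = _ := by
          rw [← ENNReal.ofReal_mul hKc0.le]
          congr 1
          field_simp
  set D : Set (X × Y) := V ×ˢ {y : Y | L2 y ≤ N0} with hDdef
  have hD : MeasurableSet D := hV.prod (measurableSet_le hL2 measurable_const)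
  have hmain : ∀ (k : ℕ) (z : X × Y), z ∉ D → ∫⁻ ω, min (hitTime D ω) k ∂chain.P z ≤ W z := by
    intro k
    induction k with
    | zero => intro z _; simp
    | succ k ih =>
      intro z hz
      by_cases hzV : z.1 ∈ V
      · have hz2 : N0 < L2 z.2 := by
          by_contra hcon
          exact hz ⟨hzV, not_lt.1 hcon⟩
        refine (hit_rec chain D hD z T hTT3 k W ih).trans ?_
        calc _ ≤ ENNReal.ofReal T + (ENNReal.ofReal T
              + ENNReal.ofReal c * ∫⁻ ω, ENNReal.ofReal (L2 (ω T).2) ∂chain.P z) := by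
              rw [ENNReal.ofReal_natCast]
              have := hWT z hzV
              rw [ENNReal.ofReal_natCast] at this
              gcongr
          _ = ENNReal.ofReal c * (∫⁻ ω, ENNReal.ofReal (L2 (ω T).2) ∂chain.P z
              + ENNReal.ofReal (T * κ / 4)) := by
              rw [mul_add, ← ENNReal.ofReal_mul hc0.le, ← add_assoc,
                ← ENNReal.ofReal_add (by positivity) (by positivity), add_comm]
              congr 2
              rw [hc]; field_simp; ring
          _ ≤ ENNReal.ofReal c * ENNReal.ofReal (L2 z.2) := by
              gcongr; exact hdrift z hzV hz2
          _ ≤ W z := by rw [hW]; exact le_add_self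
      · refine (hit_rec chain D hD z 1 le_rfl k W ih).trans ?_
        rw [hWint]
        have h1 := L2_upper chain L2 U hU hB1 z 1
        rw [Nat.cast_one, one_mul] at h1
        have h2 := L1_drift XC V hV z.1 hzV
        have hKc : ENNReal.ofReal (1 + c * U) = 1 + ENNReal.ofReal c * ENNReal.ofReal U := by
          rw [ENNReal.ofReal_add zero_le_one (by positivity), ENNReal.ofReal_mul hc0.le,
            ENNReal.ofReal_one]
        calc _ ≤ ((1 : ℕ) : ℝ≥0∞) + (ENNReal.ofReal (1 + c * U) * ∫⁻ ω, L1fun XC V (ω 1) ∂XC.P z.1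
              + ENNReal.ofReal c * (ENNReal.ofReal (L2 z.2) + ENNReal.ofReal U)) := by gcongr
          _ = ENNReal.ofReal (1 + c * U) * (1 + ∫⁻ ω, L1fun XC V (ω 1) ∂XC.P z.1)
              + ENNReal.ofReal c * ENNReal.ofReal (L2 z.2) := by
              rw [hKc, Nat.cast_one]; ring
          _ ≤ W z := by
              simp only [hW]
              exact add_le_add (mul_le_mul_right h2 _) le_rfl
  have hbound : ∀ z : X × Y, z.1 ∈ V → ∫⁻ ω, hitTime D ω ∂chain.P z ≤ T + (ENNReal.ofReal T
      + ENNReal.ofReal c * (ENNReal.ofReal (L2 z.2) + ENNReal.ofReal (T * U))) := by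
    intro z hz
    refine hit_iSup chain D hD z _ fun k => ?_
    have hk : ∫⁻ ω, min (hitTime D ω) k ∂chain.P z
        ≤ ∫⁻ ω, min (hitTime D ω) (k + 1 : ℕ) ∂chain.P z :=
      lintegral_mono fun ω => min_le_min le_rfl (by exact_mod_cast Nat.le_succ k)
    refine hk.trans ((hit_rec chain D hD z T hTT3 k W (hmain k)).trans ?_)
    gcongr
    refine (hWT z hz).trans ?_
    gcongr
    exact L2_upper chain L2 U hU hB1 z T
  refine ⟨N0, hN0pos, ?_, ?_⟩
  · intro z
    have := chain.prob z
    have hmD : MeasurableSet {ω : ℕ → X × Y | hitTime D ω < ⊤} :=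
      measurableSet_lt (hit_measurable D hD) measurable_const
    rw [← prob_compl_eq_zero_iff hmD]
    refine hit_finite chain D (V ×ˢ univ) hD (hV.prod MeasurableSet.univ) ?_ z ?_
    · intro w hw
      refine ae_lt_top (hit_measurable D hD) (ne_top_of_le_ne_top ?_ (hbound w hw.1))
      finiteness
    · have hmV : MeasurableSet {ω : ℕ → X | hitTime V ω < ⊤} :=
        measurableSet_lt (hit_measurable V hV) measurable_const
      have h1 := hVfin z.1
      rw [← hA0 z.1 z.2, Measure.map_apply proj_measurable hmV] at h1
      have h2 := (prob_compl_eq_zero_iff (proj_measurable hmV)).2 h1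
      have h3 : ∀ᵐ ω ∂chain.P z, hitTime V (fun n => (ω n).1) < ⊤ := h2
      filter_upwards [h3] with ω hω
      have : hitTime (V ×ˢ (univ : Set Y)) ω = hitTime V (fun n => (ω n).1) := by
        unfold hitTime; simp
      rw [this]; exact hω
  · refine ⟨T + (ENNReal.ofReal T + ENNReal.ofReal c *
      (ENNReal.ofReal N0 + ENNReal.ofReal (T * U))), ?_, fun z hz => (hbound z hz.1).trans ?_⟩
    · finiteness
    · have : L2 z.2 ≤ N0 := hz.2
      gcongr
end

section
/- Under Conditions A and Conditions B̃1–B̃3 there exists N1 ≥ N0 such that the set D := V × {y ∈ 𝒴 : Σ_{i=1}^M L_{2,i}(y_i) ≤ N1} is positive recurrent for the Markov chain {(X^t,Y^t)}: τ_D := min{t ≥ 1 : (X^t,Y^t) ∈ D} is P_{x,y}-a.s. finite for every initial state (x,y), and sup_{(x,y)∈D} E_{x,y}[τ_D] < ∞. -/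
open MeasureTheory ProbabilityTheory Filter Set
open scoped ENNReal

variable {M : ℕ} {Yi : Fin M → Type*} [∀ i, MeasurableSpace (Yi i)]

/-- Condition B̃1 of the paper (multivariate case): for each coordinate `i`, the absolute
increments of `L2 i` along the `i`-th coordinate of the `Y`-component have expectations
bounded by `U`, uniformly in the initial state. -/
def CondB1multi {X : Type*} [MeasurableSpace X]
    (chain : MarkovFamily (X × (∀ i, Yi i))) (L2 : ∀ i, Yi i → ℝ) (U : ℝ) : Prop :=
  (∀ i, Measurable (L2 i)) ∧ (∀ i y, 0 ≤ L2 i y) ∧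
  ∀ (i : Fin M) (x : X) (y : ∀ i, Yi i),
    ∫⁻ ω, ENNReal.ofReal |L2 i ((ω 1).2 i) - L2 i (y i)| ∂ chain.P (x, y) ≤ ENNReal.ofReal U

/-- Condition B̃2 of the paper (multivariate case): for each coordinate `i`, a drift inequality
`E_{x,y}[L2_i(Y_i^1) - L2_i(y_i)] ≤ f_i x + h_i (L2_i y_i)` with `h_i ↓ 0`, `f_i` bounded
measurable and `∫ f_i dπ = -ε_i < 0`; note that the right-hand side depends only on `x` and on
the `i`-th coordinate of `y`. -/
def CondB2multi {X : Type*} [MeasurableSpace X]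
    (chain : MarkovFamily (X × (∀ i, Yi i))) (π : Measure X) (L2 : ∀ i, Yi i → ℝ)
    (h : Fin M → ℝ → ℝ) (f : Fin M → X → ℝ) (εs : Fin M → ℝ) : Prop :=
  ∀ i : Fin M,
    Antitone (h i) ∧ (∀ r : ℝ, 0 ≤ h i r) ∧ Tendsto (h i) atTop (nhds 0) ∧
    Measurable (f i) ∧ (∃ K : ℝ, ∀ x, |f i x| ≤ K) ∧
    0 < εs i ∧ (∫ x, f i x ∂π = -εs i) ∧
    ∀ (x : X) (y : ∀ i, Yi i),
      ∫ ω, (L2 i ((ω 1).2 i) - L2 i (y i)) ∂ chain.P (x, y) ≤ f i x + h i (L2 i (y i))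

/-- Condition B̃3 of the paper: for each coordinate `i`, the `t`-step drift of `L2 i` grows
sublinearly in `t`, uniformly over `x ∈ V` and all `y`. -/
def CondB3multi {X : Type*} [MeasurableSpace X]
    (chain : MarkovFamily (X × (∀ i, Yi i))) (V : Set X) (L2 : ∀ i, Yi i → ℝ) : Prop :=
  ∀ i : Fin M, ∀ ε : ℝ, 0 < ε → ∃ N : ℕ, ∀ t ≥ N, ∀ x ∈ V, ∀ y : ∀ i, Yi i,
    ∫ ω, (L2 i ((ω t).2 i) - L2 i (y i)) ∂ chain.P (x, y) ≤ ε * t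

namespace FST

set_option linter.unusedSectionVars false

section generic

variable {S : Type*} [MeasurableSpace S]

lemma hitTime_le {D : Set S} {ω : ℕ → S} {n : ℕ} (hn : 1 ≤ n) (h : ω n ∈ D) :
    hitTime D ω ≤ n := sInf_le ⟨n, rfl, hn, h⟩

lemma le_hitTime {D : Set S} {ω : ℕ → S} {c : ℝ≥0∞}
    (h : ∀ n : ℕ, 1 ≤ n → ω n ∈ D → c ≤ n) : c ≤ hitTime D ω := by
  refine le_sInf ?_
  rintro r ⟨n, rfl, hn, hD⟩
  exact h n hn hD

lemma hitTime_eq_iInf (D : Set S) (ω : ℕ → S) :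
    hitTime D ω = ⨅ n : ℕ, ({ω : ℕ → S | 1 ≤ n ∧ ω n ∈ D}.indicator (fun _ => (n : ℝ≥0∞)) ω
      + {ω : ℕ → S | 1 ≤ n ∧ ω n ∈ D}ᶜ.indicator (fun _ => (⊤ : ℝ≥0∞)) ω) := by
  apply le_antisymm
  · refine le_iInf fun n => ?_
    by_cases h : 1 ≤ n ∧ ω n ∈ D
    · simp [indicator, h]
      exact hitTime_le h.1 h.2
    · have : ω ∈ {ω : ℕ → S | 1 ≤ n ∧ ω n ∈ D}ᶜ := h
      rw [indicator_of_mem this]; simp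
  · refine le_hitTime fun n hn hD => ?_
    refine (iInf_le _ n).trans ?_
    simp [indicator, hn, hD]

lemma measurable_hitTime {D : Set S} (hD : MeasurableSet D) :
    Measurable (hitTime D : (ℕ → S) → ℝ≥0∞) := by
  have : (hitTime D : (ℕ → S) → ℝ≥0∞) = _ := funext (hitTime_eq_iInf D)
  rw [this]
  refine Measurable.iInf fun n => ?_
  have hm : MeasurableSet {ω : ℕ → S | 1 ≤ n ∧ ω n ∈ D} :=
    (MeasurableSet.const _).inter (measurable_pi_apply n hD)
  exact (measurable_const.indicator hm).add (measurable_const.indicator hm.compl)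


end generic
end FST
namespace FST
section generic
variable {S : Type*} [MeasurableSpace S]

lemma hitTime_le_shift {D : Set S} (ω : ℕ → S) (n : ℕ) :
    hitTime D ω ≤ n + hitTime D (fun k => ω (n + k)) := by
  rw [← tsub_le_iff_left]
  refine le_hitTime fun k hk hD => ?_
  rw [tsub_le_iff_left]
  have := hitTime_le (D := D) (ω := ω) (n := n + k) (by omega) hD
  simpa using this

/-- reaching `D` no later than time `n`, or restart from time `n`. -/
lemma hitTime_le_shift' {D : Set S} (ω : ℕ → S) (n : ℕ) (hn : 1 ≤ n) :
    hitTime D ω ≤ n + {ω : ℕ → S | ω 0 ∉ D}.indicator (hitTime D) (fun k => ω (n + k)) := by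
  by_cases h : ω n ∈ D
  · exact (hitTime_le hn h).trans le_self_add
  · rw [indicator_of_mem (by simpa using h)]
    exact hitTime_le_shift ω n

lemma shift_le_hitTime {D : Set S} (ω : ℕ → S) :
    1 + {ω : ℕ → S | ω 0 ∉ D}.indicator (hitTime D) (fun k => ω (1 + k)) ≤ hitTime D ω := by
  refine le_hitTime fun n hn hD => ?_
  obtain ⟨k, rfl⟩ := Nat.exists_eq_add_of_le hn
  by_cases h : ω 1 ∈ D
  · rw [indicator_of_notMem (by simpa using h)]
    simp
  · rw [indicator_of_mem (by simpa using h)]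
    have hk : 1 ≤ k := by
      rcases Nat.eq_zero_or_pos k with rfl | h1
      · exact absurd hD h
      · exact h1
    have := hitTime_le (D := D) (ω := fun k => ω (1 + k)) hk hD
    push_cast
    gcongr

lemma measurable_shift (n : ℕ) : Measurable (fun (ω : ℕ → S) (k : ℕ) => ω (n + k)) :=
  measurable_pi_lambda _ fun k => measurable_pi_apply (n + k)

lemma measurable_at (F : MarkovFamily S) (n : ℕ) : Measurable (fun ω : ℕ → S => F.P (ω n)) :=
  F.meas.comp (measurable_pi_apply n)

lemma map_shift (F : MarkovFamily S) (z : S) (n : ℕ) :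
    Measure.map (fun (ω : ℕ → S) (k : ℕ) => ω (n + k)) (F.P z)
      = (F.P z).bind (fun ω => F.P (ω n)) := by
  ext A hA
  rw [Measure.map_apply (measurable_shift n) hA,
    Measure.bind_apply hA (measurable_at F n).aemeasurable]
  have := F.markov z n univ MeasurableSet.univ A hA
  rw [univ_inter, Measure.restrict_univ] at this
  exact this

lemma lintegral_shift (F : MarkovFamily S) (z : S) (n : ℕ) {φ : (ℕ → S) → ℝ≥0∞}
    (hφ : Measurable φ) :
    ∫⁻ ω, φ (fun k => ω (n + k)) ∂F.P z = ∫⁻ ω, ∫⁻ ω', φ ω' ∂F.P (ω n) ∂F.P z := by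
  rw [← lintegral_map hφ (measurable_shift n), map_shift,
    Measure.lintegral_bind (measurable_at F n).aemeasurable hφ.aemeasurable]

lemma ae_start_mem (F : MarkovFamily S) (z : S) {A : Set S} (hA : MeasurableSet A) (hz : z ∈ A) :
    ∀ᵐ ω ∂F.P z, ω 0 ∈ A := by
  have := F.prob z
  have hm : MeasurableSet {ω : ℕ → S | ω 0 ∈ A} := measurable_pi_apply 0 hA
  refine (mem_ae_iff_prob_eq_one hm).2 (le_antisymm prob_le_one ?_)
  rw [← F.start z]
  exact measure_mono fun ω (h : ω 0 = z) => by simpa [h] using hz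

lemma ae_start (F : MarkovFamily S) (z : S) {g : S → ℝ} (hg : Measurable g) :
    ∀ᵐ ω ∂F.P z, g (ω 0) = g z :=
  ae_start_mem F z (A := {w | g w = g z}) (hg (measurableSet_singleton _)) rfl

lemma lintegral_indicator_start (F : MarkovFamily S) (z : S) {D : Set S} (hD : MeasurableSet D)
    (φ : (ℕ → S) → ℝ≥0∞) :
    ∫⁻ ω, {ω : ℕ → S | ω 0 ∉ D}.indicator φ ω ∂F.P z
      = Dᶜ.indicator (fun z => ∫⁻ ω, φ ω ∂F.P z) z := by
  by_cases h : z ∈ D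
  · rw [indicator_of_notMem (by simpa using h)]
    rw [lintegral_congr_ae (g := fun _ => 0)]
    · simp
    · filter_upwards [ae_start_mem F z hD h] with ω hω
      rw [indicator_of_notMem (by simpa using hω)]
  · rw [indicator_of_mem h]
    apply lintegral_congr_ae
    filter_upwards [ae_start_mem F z hD.compl h] with ω hω
    rw [indicator_of_mem (by simpa using hω)]

lemma lintegral_hit_le (F : MarkovFamily S) {D : Set S} (hD : MeasurableSet D) {W : S → ℝ≥0∞}
    {φ ψ : (ℕ → S) → ℝ≥0∞} (hψ : Measurable ψ)
    (hW : ∀ z, z ∉ D → ∫⁻ ω, ψ ω ∂F.P z ≤ W z) (n : ℕ)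
    (hφψ : ∀ ω, φ ω ≤ n + {ω : ℕ → S | ω 0 ∉ D}.indicator ψ (fun k => ω (n + k))) (z : S) :
    ∫⁻ ω, φ ω ∂F.P z ≤ n + ∫⁻ ω, W (ω n) ∂F.P z := by
  have := F.prob z
  have hm : MeasurableSet {ω : ℕ → S | ω 0 ∉ D} :=
    (measurable_pi_apply (X := fun _ : ℕ => S) 0) hD.compl
  calc ∫⁻ ω, φ ω ∂F.P z ≤ ∫⁻ ω, (n + {ω : ℕ → S | ω 0 ∉ D}.indicator ψ (fun k => ω (n + k))) ∂F.P z :=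
        lintegral_mono hφψ
    _ = n + ∫⁻ ω, {ω : ℕ → S | ω 0 ∉ D}.indicator ψ (fun k => ω (n + k)) ∂F.P z := by
        rw [lintegral_add_left measurable_const]; simp
    _ = n + ∫⁻ ω, ∫⁻ ω', {ω : ℕ → S | ω 0 ∉ D}.indicator ψ ω' ∂F.P (ω n) ∂F.P z := by
        rw [lintegral_shift F z n (hψ.indicator hm)]
    _ ≤ _ := by
        gcongr with ω
        rw [lintegral_indicator_start F _ hD]
        by_cases h : ω n ∈ D
        · rw [indicator_of_notMem (by simpa using h)]; exact zero_le
        · rw [indicator_of_mem h]; exact hW _ h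

/-- Foster criterion with state-dependent (deterministic) times. -/
lemma foster (F : MarkovFamily S) {D : Set S} (hD : MeasurableSet D) {W : S → ℝ≥0∞}
    (n : S → ℕ) (hn : ∀ z, 1 ≤ n z)
    (hW : ∀ z, z ∉ D → n z + ∫⁻ ω, W (ω (n z)) ∂F.P z ≤ W z) (z : S) (hz : z ∉ D) :
    ∫⁻ ω, hitTime D ω ∂F.P z ≤ W z := by
  have key : ∀ m : ℕ, ∀ z, z ∉ D → ∫⁻ ω, min (hitTime D ω) m ∂F.P z ≤ W z := by
    intro m
    induction m with
    | zero => intro z _; simp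
    | succ m ih =>
      intro z hz
      refine le_trans ?_ (hW z hz)
      refine lintegral_hit_le F hD ((measurable_hitTime hD).min measurable_const) ih (n z) ?_ z
      intro ω
      by_cases h : ω (n z) ∈ D
      · exact (min_le_left _ _).trans ((hitTime_le (hn z) h).trans le_self_add)
      · rw [indicator_of_mem (by simpa using h)]
        rw [← min_add_add_left]
        refine min_le_min (hitTime_le_shift ω _) ?_
        have := hn z
        exact_mod_cast (by omega : m + 1 ≤ n z + m)
  have hmono : Monotone (fun (m : ℕ) (ω : ℕ → S) => min (hitTime D ω) (m : ℝ≥0∞)) := by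
    intro a b hab ω
    exact min_le_min le_rfl (by exact_mod_cast hab)
  have hs : ∀ ω : ℕ → S, hitTime D ω = ⨆ m : ℕ, min (hitTime D ω) (m : ℝ≥0∞) := by
    intro ω
    have := inf_iSup_eq (hitTime D ω) (fun m : ℕ => (m : ℝ≥0∞))
    rw [ENNReal.iSup_natCast] at this
    simpa using this
  rw [lintegral_congr hs, lintegral_iSup (fun m => (measurable_hitTime hD).min measurable_const) hmono]
  exact iSup_le fun m => key m z hz

/-- If the states in `E` hit `D` in finite mean time and `E` is hit a.s., then `D` is hit a.s. -/
lemma ae_hit (F : MarkovFamily S) {D E : Set S} (hD : MeasurableSet D) (hE : MeasurableSet E)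
    (h1 : ∀ z ∈ E, ∫⁻ ω, hitTime D ω ∂F.P z < ⊤) (z : S)
    (h2 : ∀ᵐ ω ∂F.P z, hitTime E ω < ⊤) : F.P z {ω | hitTime D ω < ⊤} = 1 := by
  have := F.prob z
  have hm : MeasurableSet {ω : ℕ → S | hitTime D ω < ⊤} :=
    measurable_hitTime hD measurableSet_Iio
  refine (mem_ae_iff_prob_eq_one hm).1 ?_
  have h3 : ∀ n : ℕ, ∀ᵐ ω ∂F.P z, ω n ∈ E → hitTime D (fun k => ω (n + k)) < ⊤ := by
    intro n
    have hm' : MeasurableSet {ω : ℕ → S | ω 0 ∈ E ∧ ¬ hitTime D ω < ⊤} :=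
      (measurable_pi_apply 0 hE).inter hm.compl
    have h4 := lintegral_shift F z n (measurable_const.indicator hm' :
      Measurable ({ω : ℕ → S | ω 0 ∈ E ∧ ¬ hitTime D ω < ⊤}.indicator (fun _ => (1 : ℝ≥0∞))))
    have h5 : ∀ w, ∫⁻ ω, {ω : ℕ → S | ω 0 ∈ E ∧ ¬ hitTime D ω < ⊤}.indicator (fun _ => (1 : ℝ≥0∞)) ω ∂F.P w = 0 := by
      intro w
      rw [lintegral_indicator hm']
      simp only [lintegral_const, MeasurableSet.univ, Measure.restrict_apply, univ_inter, one_mul]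
      rw [← compl_compl {ω : ℕ → S | ω 0 ∈ E ∧ ¬ hitTime D ω < ⊤}]
      change _ ∈ ae (F.P w)
      by_cases hw : w ∈ E
      · filter_upwards [ae_lt_top (measurable_hitTime hD) (h1 w hw).ne] with ω hω
        simp [hω.ne]
      · filter_upwards [ae_start_mem F w hE.compl hw] with ω hω
        have : ω 0 ∉ E := hω
        simp [this]
    simp only [h5, lintegral_zero] at h4
    have h6 : Measurable (fun ω : ℕ → S => {ω : ℕ → S | ω 0 ∈ E ∧ ¬ hitTime D ω < ⊤}.indicator
        (fun _ => (1 : ℝ≥0∞)) (fun k => ω (n + k))) :=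
      (measurable_const.indicator hm').comp (measurable_shift n)
    rw [lintegral_eq_zero_iff h6] at h4
    filter_upwards [h4] with ω hω hωE
    by_contra hc
    have : (fun k => ω (n + k)) ∈ {ω : ℕ → S | ω 0 ∈ E ∧ ¬ hitTime D ω < ⊤} := ⟨hωE, hc⟩
    rw [indicator_of_mem this] at hω
    simp at hω
  filter_upwards [h2, ae_all_iff.2 h3] with ω hω1 hω2
  have : ∃ n, ω n ∈ E := by
    by_contra! hc
    have : ⊤ ≤ hitTime E ω := le_hitTime fun n _ h => absurd h (hc n)
    exact absurd hω1 (not_lt.2 this)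
  obtain ⟨n, hn⟩ := this
  exact (hitTime_le_shift ω n).trans_lt (ENNReal.add_lt_top.2 ⟨ENNReal.natCast_lt_top n, hω2 n hn⟩)

end generic
end FST
namespace FST
section funct
variable {S : Type*} [MeasurableSpace S]

lemma lint_incr (F : MarkovFamily S) {g : S → ℝ} (hg : Measurable g) {U : ℝ}
    (hU : ∀ z, ∫⁻ ω, ENNReal.ofReal |g (ω 1) - g z| ∂F.P z ≤ ENNReal.ofReal U) (s : ℕ) (z : S) :
    ∫⁻ ω, ENNReal.ofReal |g (ω s) - g z| ∂F.P z ≤ s * ENNReal.ofReal U := by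
  have hgm : ∀ n : ℕ, Measurable (fun ω : ℕ → S => g (ω n)) :=
    fun n => hg.comp (measurable_pi_apply n)
  induction s with
  | zero =>
    rw [lintegral_congr_ae (g := fun _ => 0)]
    · simp
    · filter_upwards [ae_start F z hg] with ω hω
      simp [hω]
  | succ s ih =>
    have hm1 : Measurable (fun ω : ℕ → S => ENNReal.ofReal |g (ω 1) - g (ω 0)|) :=
      ((((hgm 1).sub (hgm 0))).abs).ennreal_ofReal
    have hm2 : Measurable (fun ω : ℕ → S => ENNReal.ofReal |g (ω s) - g z|) :=
      ((((hgm s).sub_const _)).abs).ennreal_ofReal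
    have h1 := lintegral_shift F z s hm1
    have h2 : ∀ w, ∫⁻ ω, ENNReal.ofReal |g (ω 1) - g (ω 0)| ∂F.P w ≤ ENNReal.ofReal U := by
      intro w
      refine le_trans (le_of_eq ?_) (hU w)
      apply lintegral_congr_ae
      filter_upwards [ae_start F w hg] with ω hω
      rw [hω]
    have := F.prob z
    calc ∫⁻ ω, ENNReal.ofReal |g (ω (s+1)) - g z| ∂F.P z
        ≤ ∫⁻ ω, (ENNReal.ofReal |g (ω s) - g z| + ENNReal.ofReal |g (ω (s+1)) - g (ω (s+0))|) ∂F.P z := by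
          refine lintegral_mono fun ω => ?_
          rw [← ENNReal.ofReal_add (abs_nonneg _) (abs_nonneg _)]
          refine ENNReal.ofReal_le_ofReal ?_
          refine le_trans ?_ (add_comm _ _).le
          exact abs_sub_le (g (ω (s+1))) (g (ω s)) (g z)
      _ = ∫⁻ ω, ENNReal.ofReal |g (ω s) - g z| ∂F.P z
          + ∫⁻ ω, ∫⁻ ω', ENNReal.ofReal |g (ω' 1) - g (ω' 0)| ∂F.P (ω s) ∂F.P z := by
          rw [lintegral_add_left hm2, ← h1]
      _ ≤ s * ENNReal.ofReal U + ∫⁻ ω, ENNReal.ofReal U ∂F.P z :=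
          add_le_add ih (lintegral_mono fun ω => h2 _)
      _ = _ := by simp; ring

lemma integrable_incr (F : MarkovFamily S) {g : S → ℝ} (hg : Measurable g) {U : ℝ}
    (hU : ∀ z, ∫⁻ ω, ENNReal.ofReal |g (ω 1) - g z| ∂F.P z ≤ ENNReal.ofReal U) (s : ℕ) (z : S) :
    Integrable (fun ω => g (ω s) - g z) (F.P z) := by
  refine ⟨((hg.comp (measurable_pi_apply s)).sub_const _).aestronglyMeasurable, ?_⟩
  refine lt_of_le_of_lt (le_of_eq ?_) ((lint_incr F hg hU s z).trans_lt
    (ENNReal.mul_lt_top (ENNReal.natCast_lt_top s) ENNReal.ofReal_lt_top))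
  simp only [← ofReal_norm, Real.norm_eq_abs]

lemma integrable_at (F : MarkovFamily S) {g : S → ℝ} (hg : Measurable g) {U : ℝ}
    (hU : ∀ z, ∫⁻ ω, ENNReal.ofReal |g (ω 1) - g z| ∂F.P z ≤ ENNReal.ofReal U) (s : ℕ) (z : S) :
    Integrable (fun ω => g (ω s)) (F.P z) := by
  have := F.prob z
  refine ((integrable_incr F hg hU s z).add (integrable_const (g z))).congr
    (Eventually.of_forall fun ω => ?_)
  simp

lemma int_incr (F : MarkovFamily S) {g : S → ℝ} (hg : Measurable g) {U : ℝ} (hU0 : 0 ≤ U)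
    (hU : ∀ z, ∫⁻ ω, ENNReal.ofReal |g (ω 1) - g z| ∂F.P z ≤ ENNReal.ofReal U) (s : ℕ) (z : S) :
    ∫ ω, |g (ω s) - g z| ∂F.P z ≤ s * U := by
  have h1 := ofReal_integral_eq_lintegral_ofReal (integrable_incr F hg hU s z).abs
    (Eventually.of_forall fun _ => abs_nonneg _)
  have h2 := lint_incr F hg hU s z
  rw [← h1, ← ENNReal.ofReal_natCast, ← ENNReal.ofReal_mul (by positivity)] at h2
  exact (ENNReal.ofReal_le_ofReal_iff (by positivity)).1 h2

lemma drift_sum (F : MarkovFamily S) {g : S → ℝ} (hg : Measurable g) (hg0 : ∀ z, 0 ≤ g z) {U : ℝ}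
    (hU : ∀ z, ∫⁻ ω, ENNReal.ofReal |g (ω 1) - g z| ∂F.P z ≤ ENNReal.ofReal U)
    {q : S → ℝ} (hq : Measurable q) {Q : ℝ} (hQ : ∀ z, |q z| ≤ Q)
    (hd : ∀ z, ∫ ω, (g (ω 1) - g z) ∂F.P z ≤ q z) (t : ℕ) (z : S) :
    ∫ ω, g (ω t) ∂F.P z ≤ g z + ∑ s ∈ Finset.range t, ∫ ω, q (ω s) ∂F.P z := by
  have := F.prob z
  have hgm : ∀ n : ℕ, Measurable (fun ω : ℕ → S => g (ω n)) :=
    fun n => hg.comp (measurable_pi_apply n)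
  have hd' : ∀ z, ∫ ω, g (ω 1) ∂F.P z ≤ g z + q z := by
    intro z
    have := F.prob z
    have h1 := hd z
    rw [integral_sub (integrable_at F hg hU 1 z) (integrable_const _)] at h1
    simp at h1
    linarith
  have hnn : ∀ z, 0 ≤ g z + q z := fun z => (integral_nonneg fun ω => hg0 _).trans (hd' z)
  have hqi : ∀ s : ℕ, Integrable (fun ω => q (ω s)) (F.P z) := fun s =>
    Integrable.of_bound (hq.comp (measurable_pi_apply s)).aestronglyMeasurable Q
      (Eventually.of_forall fun ω => hQ _)
  induction t with
  | zero =>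
    simp
    rw [integral_congr_ae (g := fun _ => g z) (ae_start F z hg)]
    simp
  | succ t ih =>
    rw [Finset.sum_range_succ]
    have h1 := lintegral_shift F z t (hgm 1).ennreal_ofReal
    have h2 : ∀ w, ∫⁻ ω, ENNReal.ofReal (g (ω 1)) ∂F.P w ≤ ENNReal.ofReal (g w + q w) := by
      intro w
      rw [← ofReal_integral_eq_lintegral_ofReal (integrable_at F hg hU 1 w)
        (Eventually.of_forall fun _ => hg0 _)]
      exact ENNReal.ofReal_le_ofReal (hd' w)
    have h3 : ∫⁻ ω, ENNReal.ofReal (g (ω (t+1))) ∂F.P z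
        ≤ ∫⁻ ω, ENNReal.ofReal (g (ω t) + q (ω t)) ∂F.P z := by
      rw [h1]; exact lintegral_mono fun ω => h2 _
    rw [← ofReal_integral_eq_lintegral_ofReal (integrable_at F hg hU _ z)
        (Eventually.of_forall fun _ => hg0 _),
      ← ofReal_integral_eq_lintegral_ofReal (f := fun ω : ℕ → S => g (ω t) + q (ω t))
        ((integrable_at F hg hU _ z).add (hqi t))
        (Eventually.of_forall fun _ => hnn _),
      ENNReal.ofReal_le_ofReal_iff (integral_nonneg fun ω => hnn _),
      integral_add (integrable_at F hg hU _ z) (hqi t)] at h3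
    linarith

lemma h_bound (F : MarkovFamily S) {g : S → ℝ} (hg : Measurable g) (hg0 : ∀ z, 0 ≤ g z) {U : ℝ}
    (hU0 : 0 ≤ U)
    (hU : ∀ z, ∫⁻ ω, ENNReal.ofReal |g (ω 1) - g z| ∂F.P z ≤ ENNReal.ofReal U)
    {h : ℝ → ℝ} (ha : Antitone h) (h0 : ∀ r, 0 ≤ h r) (ht : Tendsto h atTop (nhds 0))
    (t : ℕ) {η : ℝ} (hη : 0 < η) :
    ∃ R : ℝ, ∀ z, R ≤ g z → ∀ s ≤ t, ∫ ω, h (g (ω s)) ∂F.P z ≤ η := by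
  obtain ⟨r, hr⟩ := (ht.eventually (ge_mem_nhds (half_pos hη))).exists
  set K : ℝ := 1 + 2 * (h 0 * (t * U)) / η with hK
  have hh0 := h0 0
  have hKp : 0 < K := by positivity
  have hK2 : h 0 / K * (t * U) ≤ η / 2 := by
    rw [div_mul_eq_mul_div, div_le_iff₀ hKp, hK]
    field_simp
    nlinarith
  refine ⟨r + K, fun z hz s hs => ?_⟩
  have := F.prob z
  have hpt : ∀ ω : ℕ → S, h (g (ω s)) ≤ h r + h 0 / K * |g (ω s) - g z| := by
    intro ω
    by_cases hc : r ≤ g (ω s)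
    · have := ha hc
      have : 0 ≤ h 0 / K * |g (ω s) - g z| := by positivity
      linarith
    · have h1 := ha (hg0 (ω s))
      have h2 : K ≤ |g (ω s) - g z| := by
        rw [abs_sub_comm]
        exact le_trans (by linarith) (le_abs_self _)
      have h3 : h 0 ≤ h 0 / K * |g (ω s) - g z| := by
        rw [div_mul_eq_mul_div, le_div_iff₀ hKp]
        exact mul_le_mul_of_nonneg_left h2 hh0
      have := h0 r
      linarith
  have hi := (integrable_incr F hg hU s z).abs
  have hst : (s : ℝ) * U ≤ t * U := mul_le_mul_of_nonneg_right (by exact_mod_cast hs) hU0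
  calc ∫ ω, h (g (ω s)) ∂F.P z ≤ ∫ ω, (h r + h 0 / K * |g (ω s) - g z|) ∂F.P z := by
        refine integral_mono_of_nonneg (Eventually.of_forall fun _ => h0 _)
          ((integrable_const _).add (hi.const_mul _)) (Eventually.of_forall hpt)
    _ = h r + h 0 / K * ∫ ω, |g (ω s) - g z| ∂F.P z := by
        rw [integral_add (integrable_const _) (hi.const_mul _), integral_const_mul]; simp
    _ ≤ η / 2 + h 0 / K * (t * U) := by
        refine add_le_add hr (mul_le_mul_of_nonneg_left
          ((int_incr F hg hU0 hU s z).trans hst) (by positivity))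
    _ ≤ η := by linarith

/-- one-sided total variation bound for integrals of bounded functions -/
lemma tv_bound {μ ν : Measure S} [IsProbabilityMeasure μ] [IsProbabilityMeasure ν]
    {f : S → ℝ} (hf : Measurable f) {K ε : ℝ} (hK : ∀ x, |f x| ≤ K) (hK0 : 0 ≤ K) (hε : 0 ≤ ε)
    (h : ∀ B, MeasurableSet B → |(μ B).toReal - (ν B).toReal| ≤ ε) :
    ∫ x, f x ∂μ ≤ ∫ x, f x ∂ν + 2 * K * ε := by
  have hB : ∀ B, MeasurableSet B → μ B ≤ ν B + ENNReal.ofReal ε := by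
    intro B hB
    have := (abs_le.1 (h B hB)).2
    rw [← ENNReal.ofReal_toReal (measure_ne_top μ B), ← ENNReal.ofReal_toReal (measure_ne_top ν B),
      ← ENNReal.ofReal_add ENNReal.toReal_nonneg hε]
    exact ENNReal.ofReal_le_ofReal (by linarith)
  have hg0 : ∀ x, 0 ≤ f x + K := fun x => by linarith [(abs_le.1 (hK x)).1]
  have hgm : Measurable (fun x => f x + K) := hf.add_const K
  have hi : ∀ (ρ : Measure S) [IsProbabilityMeasure ρ], Integrable f ρ := fun ρ _ =>
    Integrable.of_bound hf.aestronglyMeasurable K (Eventually.of_forall hK)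
  have key : ∫⁻ x, ENNReal.ofReal (f x + K) ∂μ
      ≤ ∫⁻ x, ENNReal.ofReal (f x + K) ∂ν + ENNReal.ofReal (2 * K * ε) := by
    rw [lintegral_eq_lintegral_meas_lt μ (Eventually.of_forall hg0) hgm.aemeasurable,
      lintegral_eq_lintegral_meas_lt ν (Eventually.of_forall hg0) hgm.aemeasurable]
    calc ∫⁻ t in Ioi 0, μ {a | t < f a + K}
        ≤ ∫⁻ t in Ioi (0:ℝ), (ν {a | t < f a + K}
            + (Iio (2 * K)).indicator (fun _ => ENNReal.ofReal ε) t) := by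
          refine lintegral_mono fun t => ?_
          by_cases ht : t < 2 * K
          · rw [indicator_of_mem (by exact ht)]
            exact hB _ (measurableSet_lt measurable_const hgm)
          · have : {a | t < f a + K} = ∅ := by
              ext a
              simp only [mem_ofPred_eq, mem_empty_iff_false, iff_false]
              have := (abs_le.1 (hK a)).2
              linarith
            simp [this]
      _ = (∫⁻ t in Ioi (0:ℝ), ν {a | t < f a + K})
          + ∫⁻ t in Ioi (0:ℝ), (Iio (2 * K)).indicator (fun _ => ENNReal.ofReal ε) t :=
          lintegral_add_right _ (measurable_const.indicator measurableSet_Iio)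
      _ = _ := by
          congr 1
          rw [lintegral_indicator measurableSet_Iio, lintegral_const]
          simp only [Measure.restrict_apply, MeasurableSet.univ, univ_inter,
            measurableSet_Iio]
          rw [Iio_inter_Ioi, Real.volume_Ioo, ← ENNReal.ofReal_mul hε]
          congr 1; ring
  rw [← ofReal_integral_eq_lintegral_ofReal (f := fun x => f x + K) ((hi μ).add (integrable_const K))
        (Eventually.of_forall hg0),
    ← ofReal_integral_eq_lintegral_ofReal (f := fun x => f x + K) ((hi ν).add (integrable_const K))
        (Eventually.of_forall hg0),
    ← ENNReal.ofReal_add (integral_nonneg hg0) (by positivity),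
    ENNReal.ofReal_le_ofReal_iff (add_nonneg (integral_nonneg hg0) (by positivity)),
    integral_add (hi μ) (integrable_const K), integral_add (hi ν) (integrable_const K)] at key
  simp at key
  linarith

end funct
end FST
namespace FST
section main
variable {X Y : Type*} [MeasurableSpace X] [MeasurableSpace Y]

lemma f_sum (XC : MarkovFamily X) {V : Set X} {π : Measure X} [IsProbabilityMeasure π]
    (hTV : ∀ ε : ℝ, 0 < ε → ∃ T : ℕ, ∀ t ≥ T, ∀ x ∈ V, ∀ B : Set X, MeasurableSet B →
      |(XC.P x {ω | ω t ∈ B}).toReal - (π B).toReal| ≤ ε)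
    {f : X → ℝ} (hf : Measurable f) {K : ℝ} (hK : ∀ x, |f x| ≤ K) (hK0 : 0 ≤ K)
    {e : ℝ} (he : 0 < e) (hfe : ∫ x, f x ∂π = -e) :
    ∃ T : ℕ, ∀ t ≥ T, ∀ x ∈ V, ∑ s ∈ Finset.range t, ∫ ω, f (ω s) ∂XC.P x ≤ -(e / 2) * t := by
  obtain ⟨T0, hT0⟩ := hTV (e / (8 * (K + 1))) (by positivity)
  obtain ⟨T1, hT1⟩ := exists_nat_ge (4 * (T0 * (K + e)) / e)
  refine ⟨T1 + T0, fun t ht x hx => ?_⟩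
  have hP := XC.prob x
  have hT0t : T0 ≤ t := by omega
  have h1 : ∀ s ∈ Finset.range t, ∫ ω, f (ω s) ∂XC.P x
      ≤ -(3 * e / 4) + (if s < T0 then K + e else 0) := by
    intro s _
    by_cases hs : s < T0
    · rw [if_pos hs]
      have : ∫ ω, f (ω s) ∂XC.P x ≤ ∫ ω, K ∂XC.P x := by
        refine integral_mono (Integrable.of_bound
          (hf.comp (measurable_pi_apply s)).aestronglyMeasurable K
          (Eventually.of_forall fun ω => hK _)) (integrable_const _)
          (fun ω => (abs_le.1 (hK _)).2)
      simp at this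
      linarith
    · rw [if_neg hs]
      have hm : Measurable (fun ω : ℕ → X => ω s) := measurable_pi_apply s
      have hPm : IsProbabilityMeasure (Measure.map (fun ω : ℕ → X => ω s) (XC.P x)) :=
        Measure.isProbabilityMeasure_map hm.aemeasurable
      have h2 := tv_bound (μ := Measure.map (fun ω : ℕ → X => ω s) (XC.P x)) (ν := π) hf hK hK0
        (ε := e / (8 * (K + 1))) (by positivity) (by
          intro B hB
          rw [Measure.map_apply hm hB]
          exact hT0 s (by omega) x hx B hB)
      rw [integral_map hm.aemeasurable hf.aestronglyMeasurable, hfe] at h2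
      have h3 : 2 * K * (e / (8 * (K + 1))) ≤ e / 4 := by
        rw [mul_div_assoc', div_le_div_iff₀ (by positivity) (by positivity)]
        nlinarith
      linarith
  refine (Finset.sum_le_sum h1).trans ?_
  rw [Finset.sum_add_distrib, ← Finset.sum_filter]
  have h4 : (Finset.range t).filter (fun s => s < T0) = Finset.range T0 := by
    ext s; simp; omega
  rw [h4]
  simp only [Finset.sum_const, Finset.card_range, nsmul_eq_mul]
  rw [div_le_iff₀ he] at hT1
  have h5 : (T1 : ℝ) ≤ t := by exact_mod_cast (by omega : T1 ≤ t)
  nlinarith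

lemma coord_drift (chain : MarkovFamily (X × Y)) (XC : MarkovFamily X) {V : Set X} {π : Measure X}
    [IsProbabilityMeasure π]
    (hA0 : ∀ x y, Measure.map (fun (ω : ℕ → X × Y) (n : ℕ) => (ω n).1) (chain.P (x, y)) = XC.P x)
    (hTV : ∀ ε : ℝ, 0 < ε → ∃ T : ℕ, ∀ t ≥ T, ∀ x ∈ V, ∀ B : Set X, MeasurableSet B →
      |(XC.P x {ω | ω t ∈ B}).toReal - (π B).toReal| ≤ ε)
    {g : X × Y → ℝ} (hg : Measurable g) (hg0 : ∀ z, 0 ≤ g z) {U : ℝ} (hU0 : 0 ≤ U)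
    (hU : ∀ z, ∫⁻ ω, ENNReal.ofReal |g (ω 1) - g z| ∂chain.P z ≤ ENNReal.ofReal U)
    {h : ℝ → ℝ} (ha : Antitone h) (h0 : ∀ r, 0 ≤ h r) (ht : Tendsto h atTop (nhds 0))
    {f : X → ℝ} (hf : Measurable f) {K : ℝ} (hK : ∀ x, |f x| ≤ K)
    {e : ℝ} (he : 0 < e) (hfe : ∫ x, f x ∂π = -e)
    (hd : ∀ z, ∫ ω, (g (ω 1) - g z) ∂chain.P z ≤ f z.1 + h (g z)) :
    ∃ T : ℕ, ∀ t ≥ T, ∃ R : ℝ, ∀ x ∈ V, ∀ y, R ≤ g (x, y) →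
      ∫ ω, g (ω t) ∂chain.P (x, y) ≤ g (x, y) - e / 4 * t := by
  have hK' : ∀ x, |f x| ≤ |K| := fun x => (hK x).trans (le_abs_self _)
  obtain ⟨T, hT⟩ := f_sum XC hTV hf hK' (abs_nonneg _) he hfe
  refine ⟨T, fun t htT => ?_⟩
  obtain ⟨R, hR⟩ := h_bound chain hg hg0 hU0 hU ha h0 ht t (show 0 < e / 4 by positivity)
  refine ⟨R, fun x hx y hy => ?_⟩
  have hP := chain.prob (x, y)
  have hhg : Measurable (fun z => h (g z)) := ha.measurable.comp hg
  have hhb : ∀ z, |h (g z)| ≤ h 0 := fun z => by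
    rw [abs_of_nonneg (h0 _)]; exact ha (hg0 z)
  have h1 := drift_sum chain hg hg0 hU (q := fun z => f z.1 + h (g z))
    ((hf.comp measurable_fst).add hhg) (Q := |K| + h 0)
    (fun z => (abs_add_le _ _).trans (add_le_add (hK' _) (hhb z))) hd t (x, y)
  have hpm : Measurable (fun (ω : ℕ → X × Y) (n : ℕ) => (ω n).1) :=
    measurable_pi_lambda _ fun n => measurable_fst.comp (measurable_pi_apply n)
  have h2 : ∀ s ∈ Finset.range t, ∫ ω, (f (ω s).1 + h (g (ω s))) ∂chain.P (x, y)
      ≤ ∫ ω, f (ω s) ∂XC.P x + e / 4 := by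
    intro s hs
    have i1 : Integrable (fun ω : ℕ → X × Y => f (ω s).1) (chain.P (x, y)) :=
      Integrable.of_bound ((hf.comp measurable_fst).comp
        (measurable_pi_apply s)).aestronglyMeasurable |K| (Eventually.of_forall fun ω => hK' _)
    have i2 : Integrable (fun ω : ℕ → X × Y => h (g (ω s))) (chain.P (x, y)) :=
      Integrable.of_bound (hhg.comp
        (measurable_pi_apply s)).aestronglyMeasurable (h 0) (Eventually.of_forall fun ω => hhb _)
    rw [integral_add i1 i2, ← hA0 x y, integral_map (f := fun ω : ℕ → X => f (ω s)) hpm.aemeasurable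
      (hf.comp (measurable_pi_apply s)).aestronglyMeasurable]
    exact add_le_add le_rfl (hR _ hy s (Finset.mem_range.1 hs).le)
  have h3 := Finset.sum_le_sum h2
  rw [Finset.sum_add_distrib] at h3
  simp only [Finset.sum_const, Finset.card_range, nsmul_eq_mul] at h3
  have h4 := hT t htT x hx
  linarith

lemma L1fun_eq (XC : MarkovFamily X) (V : Set X) :
    L1fun XC V = Vᶜ.indicator (fun x => ∫⁻ ω, hitTime V ω ∂ XC.P x) := by
  ext x
  by_cases h : x ∈ V <;> simp [L1fun, indicator, h]

lemma measurable_L1fun (XC : MarkovFamily X) {V : Set X} (hV : MeasurableSet V) :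
    Measurable (L1fun XC V) := by
  rw [L1fun_eq]
  exact ((Measure.measurable_lintegral (measurable_hitTime hV)).comp XC.meas).indicator hV.compl

lemma L1_step (XC : MarkovFamily X) {V : Set X} (hV : MeasurableSet V) {x : X} (hx : x ∉ V) :
    1 + ∫⁻ ω, L1fun XC V (ω 1) ∂XC.P x ≤ L1fun XC V x := by
  have := XC.prob x
  have hm : MeasurableSet {ω : ℕ → X | ω 0 ∉ V} :=
    (measurable_pi_apply (X := fun _ : ℕ => X) 0) hV.compl
  have h1 := lintegral_shift XC x 1 ((measurable_hitTime hV).indicator hm)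
  simp only [lintegral_indicator_start XC _ hV, ← L1fun_eq XC V] at h1
  rw [← h1]
  have h2 : L1fun XC V x = ∫⁻ ω, hitTime V ω ∂ XC.P x := by simp [L1fun, hx]
  rw [h2]
  refine le_trans (le_of_eq ?_) (lintegral_mono fun ω => shift_le_hitTime ω)
  rw [lintegral_add_left measurable_const]; simp

end main
end FST
/-- **Theorem 2** (Foss–Shneer–Tyurlikov, multivariate stability). Under Conditions A and
B̃1–B̃3, there is `N1 > 0` such that the set
`D = V × {y : Σ_i L2_i(y_i) ≤ N1}` is positive recurrent for the chain `{(X^t, Y^t)}`. -/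
theorem theorem2_multivariate_positive_recurrence
    {X : Type*} [MeasurableSpace X] [MeasurableSpace.CountablyGenerated X]
    {M : ℕ} (hM : 0 < M) {Yi : Fin M → Type*} [∀ i, MeasurableSpace (Yi i)]
    (chain : MarkovFamily (X × (∀ i, Yi i))) (XC : MarkovFamily X) (V : Set X) (π : Measure X)
    (L2 : ∀ i, Yi i → ℝ) (U : ℝ) (h : Fin M → ℝ → ℝ) (f : Fin M → X → ℝ) (εs : Fin M → ℝ)
    (hA : CondA chain XC V π)
    (hB1 : CondB1multi chain L2 U)
    (hB2 : CondB2multi chain π L2 h f εs)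
    (hB3 : CondB3multi chain V L2) :
    ∃ N1 : ℝ, 0 < N1 ∧
      PosRec chain (V ×ˢ {y : ∀ i, Yi i | ∑ i, L2 i (y i) ≤ N1}) := by
  classical
  obtain ⟨hV, hA0, hfin, -, hπ, -, -, hTV, hL1⟩ := hA
  obtain ⟨hLm, hL0, hU⟩ := hB1
  -- a nonnegative version of the constant `U`
  obtain ⟨u, hu0, hUu⟩ : ∃ u : ℝ, 0 ≤ u ∧ ENNReal.ofReal U ≤ ENNReal.ofReal u :=
    ⟨max U 0, le_max_right _ _, ENNReal.ofReal_le_ofReal (le_max_left _ _)⟩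
  set g : Fin M → X × (∀ i, Yi i) → ℝ := fun i z => L2 i (z.2 i) with hgdef
  have hg : ∀ i, Measurable (g i) := fun i =>
    (hLm i).comp ((measurable_pi_apply i).comp measurable_snd)
  have hg0 : ∀ i z, 0 ≤ g i z := fun i z => hL0 i _
  have hUg : ∀ i z, ∫⁻ ω, ENNReal.ofReal |g i (ω 1) - g i z| ∂chain.P z ≤ ENNReal.ofReal u :=
    fun i z => (hU i z.1 z.2).trans hUu
  have hint : ∀ i (t : ℕ) z, Integrable (fun ω => g i (ω t)) (chain.P z) := fun i t z =>
    FST.integrable_at chain (hg i) (hUg i) t z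
  have hMr : (0 : ℝ) < M := by exact_mod_cast hM
  -- uniform constant `e`
  have hε : ∀ i, 0 < εs i := fun i => (hB2 i).2.2.2.2.2.1
  obtain ⟨e, he, hee⟩ : ∃ e : ℝ, 0 < e ∧ ∀ i, e ≤ εs i / 4 := by
    have : Nonempty (Fin M) := ⟨⟨0, hM⟩⟩
    obtain ⟨i0, hi0⟩ := Finite.exists_min εs
    exact ⟨εs i0 / 4, by linarith [hε i0], fun i => by linarith [hi0 i]⟩
  -- constants
  set c : ℝ := M * u + 1 with hc
  have hc1 : 0 < c := by positivity
  have hdrift : ∀ i, ∃ T : ℕ, ∀ t ≥ T, ∃ R : ℝ, ∀ x ∈ V, ∀ y, R ≤ g i (x, y) →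
      ∫ ω, g i (ω t) ∂chain.P (x, y) ≤ g i (x, y) - e * t := by
    intro i
    obtain ⟨b1, b2, b3, b4, ⟨K, b5⟩, b6, b7, b8⟩ := hB2 i
    obtain ⟨T, hT⟩ := FST.coord_drift chain XC hA0 hTV (hg i) (hg0 i) hu0 (hUg i) b1 b2 b3 b4 b5
      b6 b7 (fun z => b8 z.1 z.2)
    refine ⟨T, fun t ht => ?_⟩
    obtain ⟨R, hR⟩ := hT t ht
    refine ⟨R, fun x hx y hy => (hR x hx y hy).trans ?_⟩
    have : e * t ≤ εs i / 4 * t := mul_le_mul_of_nonneg_right (hee i) (Nat.cast_nonneg t)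
    linarith
  choose T hT using hdrift
  choose N hN using fun i => hB3 i (e / (2 * M)) (by positivity)
  obtain ⟨TL, hTL⟩ := hL1 (e / (4 * c)) (by positivity)
  set t : ℕ := 1 + ∑ i, T i + ∑ i, N i + TL with htdef
  have htT : ∀ i, T i ≤ t := fun i => by
    have := Finset.single_le_sum (f := T) (fun _ _ => Nat.zero_le _) (Finset.mem_univ i)
    omega
  have htN : ∀ i, N i ≤ t := fun i => by
    have := Finset.single_le_sum (f := N) (fun _ _ => Nat.zero_le _) (Finset.mem_univ i)
    omega
  have ht1 : 1 ≤ t := by omega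
  choose R hR using fun i => hT i t (htT i)
  have hsub : ∀ i, ∀ x ∈ V, ∀ y, ∫ ω, g i (ω t) ∂chain.P (x, y) ≤ g i (x, y) + e / (2 * M) * t := by
    intro i x hx y
    have hP := chain.prob (x, y)
    have h1 := hN i t (htN i) x hx y
    change ∫ ω, (g i (ω t) - g i (x, y)) ∂chain.P (x, y) ≤ _ at h1
    rw [integral_sub (hint i t _) (integrable_const _)] at h1
    simp at h1
    linarith
  -- the truncation level
  set R0 : ℝ := 1 + ∑ i, |R i| with hR0
  have hR0i : ∀ i, R i ≤ R0 := fun i => by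
    have := Finset.single_le_sum (f := fun i => |R i|) (fun _ _ => abs_nonneg _) (Finset.mem_univ i)
    have := le_abs_self (R i)
    linarith
  have hR0p : 0 < R0 := by
    have : 0 ≤ ∑ i, |R i| := Finset.sum_nonneg fun _ _ => abs_nonneg _
    linarith
  refine ⟨M * R0, by positivity, ?_⟩
  set N1 : ℝ := M * R0 with hN1
  set D : Set (X × (∀ i, Yi i)) := V ×ˢ {y : ∀ i, Yi i | ∑ i, L2 i (y i) ≤ N1} with hDdef
  have hD : MeasurableSet D := by
    refine hV.prod ?_
    refine measurableSet_le (Finset.measurable_sum _ fun i _ => ?_) measurable_const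
    exact (hLm i).comp (measurable_pi_apply i)
  set a : ℝ := 1 + 4 / e with ha
  have ha1 : 1 ≤ a := by
    have : 0 < 4 / e := by positivity
    linarith
  have hae : 1 ≤ a * (e / 4) := by
    rw [ha]; field_simp; linarith
  set W : X × (∀ i, Yi i) → ℝ≥0∞ := fun z =>
    ENNReal.ofReal a * (ENNReal.ofReal c * L1fun XC V z.1 + ENNReal.ofReal (∑ i, g i z)) with hW
  have hpm : Measurable (fun (ω : ℕ → X × (∀ i, Yi i)) (n : ℕ) => (ω n).1) :=
    measurable_pi_lambda _ fun n => measurable_fst.comp (measurable_pi_apply n)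
  have hL1m := FST.measurable_L1fun XC hV
  have hWint : ∀ (s : ℕ) x y, ∫⁻ ω, W (ω s) ∂chain.P (x, y)
      = ENNReal.ofReal a * (ENNReal.ofReal c * ∫⁻ ω, L1fun XC V (ω s) ∂XC.P x
        + ENNReal.ofReal (∑ i, ∫ ω, g i (ω s) ∂chain.P (x, y))) := by
    intro s x y
    have m1 : Measurable (fun ω : ℕ → X × (∀ i, Yi i) => L1fun XC V (ω s).1) :=
      hL1m.comp (measurable_fst.comp (measurable_pi_apply s))
    have m2 : Measurable (fun ω : ℕ → X × (∀ i, Yi i) => ENNReal.ofReal (∑ i, g i (ω s))) :=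
      (Finset.measurable_sum _ fun i _ => (hg i).comp (measurable_pi_apply s)).ennreal_ofReal
    have m3 : Measurable (fun ω : ℕ → X => L1fun XC V (ω s)) := hL1m.comp (measurable_pi_apply s)
    have m4 : Measurable (fun ω : ℕ → X × (∀ i, Yi i) =>
        ENNReal.ofReal c * L1fun XC V (ω s).1 + ENNReal.ofReal (∑ i, g i (ω s))) :=
      (m1.const_mul _).add m2
    simp only [hW]
    rw [lintegral_const_mul _ m4, lintegral_add_left (m1.const_mul _),
      lintegral_const_mul _ m1, ← hA0 x y, lintegral_map m3 hpm,
      ← ofReal_integral_eq_lintegral_ofReal (integrable_finsetSum _ fun i _ => hint i s _)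
        (Eventually.of_forall fun ω => Finset.sum_nonneg fun i _ => hg0 i _),
      integral_finsetSum _ fun i _ => hint i s _]
  have hgi_nonneg : ∀ (s : ℕ) z, 0 ≤ ∑ i, ∫ ω, g i (ω s) ∂chain.P z := fun s z =>
    Finset.sum_nonneg fun i _ => integral_nonneg fun ω => hg0 i _
  have hgup : ∀ (s : ℕ) z, ∑ i, ∫ ω, g i (ω s) ∂chain.P z ≤ ∑ i, g i z + M * (s * u) := by
    intro s z
    have hP := chain.prob z
    have : ∀ i ∈ Finset.univ, ∫ ω, g i (ω s) ∂chain.P z ≤ g i z + s * u := by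
      intro i _
      have h1 := FST.int_incr chain (hg i) hu0 (hUg i) s z
      have h2 : ∫ ω, (g i (ω s) - g i z) ∂chain.P z ≤ ∫ ω, |g i (ω s) - g i z| ∂chain.P z :=
        integral_mono (FST.integrable_incr chain (hg i) (hUg i) s z)
          (FST.integrable_incr chain (hg i) (hUg i) s z).abs (fun ω => le_abs_self _)
      rw [integral_sub (hint i s _) (integrable_const _)] at h2
      simp at h2
      linarith
    refine (Finset.sum_le_sum this).trans ?_
    rw [Finset.sum_add_distrib]
    simp
  have hgs0 : ∀ z, 0 ≤ ∑ i, g i z := fun z => Finset.sum_nonneg fun i _ => hg0 i z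
  -- state-dependent drift
  have hfoster : ∀ z, z ∉ D → ∫⁻ ω, hitTime D ω ∂chain.P z ≤ W z := by
    refine FST.foster chain hD (fun z => if z.1 ∈ V then t else 1)
      (fun z => by split_ifs <;> omega) ?_
    rintro ⟨x, y⟩ hz
    by_cases hx : x ∈ V
    · simp only [hx, if_true]
      rw [hWint]
      have hl := hTL t (by omega) x hx
      have hbig : N1 < ∑ i, g i (x, y) := by
        by_contra hcon
        exact hz ⟨hx, not_lt.1 hcon⟩
      obtain ⟨i, hi⟩ : ∃ i, R0 < g i (x, y) := by
        by_contra! hcon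
        have := Finset.sum_le_sum (s := Finset.univ) (fun i _ => hcon i)
        simp only [Finset.sum_const, Finset.card_univ, Fintype.card_fin, nsmul_eq_mul] at this
        linarith
      have hsum : ∑ j, ∫ ω, g j (ω t) ∂chain.P (x, y) ≤ ∑ j, g j (x, y) - e / 2 * t := by
        have h1 : ∀ j ∈ Finset.univ, ∫ ω, g j (ω t) ∂chain.P (x, y)
            ≤ g j (x, y) + e / (2 * M) * t + (if j = i then - (e * t) else 0) := by
          intro j _
          split_ifs with hji
          · subst hji
            have h2 := hR j x hx y ((hR0i j).trans hi.le)
            have h3 : 0 ≤ e / (2 * M) * t := by positivity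
            linarith
          · simpa using hsub j x hx y
        refine (Finset.sum_le_sum h1).trans ?_
        rw [Finset.sum_add_distrib, Finset.sum_add_distrib, Finset.sum_ite_eq' Finset.univ i]
        simp only [Finset.sum_const, Finset.card_univ, Fintype.card_fin, nsmul_eq_mul,
          Finset.mem_univ, if_true]
        have : (M : ℝ) * (e / (2 * M) * t) = e / 2 * t := by field_simp
        linarith
      have hWz : W (x, y) = ENNReal.ofReal (a * ∑ i, g i (x, y)) := by
        rw [ENNReal.ofReal_mul (by linarith)]
        simp [hW, L1fun, hx]
      rw [hWz]
      calc (t : ℝ≥0∞) + ENNReal.ofReal a * (ENNReal.ofReal c * ∫⁻ ω, L1fun XC V (ω t) ∂XC.P x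
            + ENNReal.ofReal (∑ i, ∫ ω, g i (ω t) ∂chain.P (x, y)))
          ≤ ENNReal.ofReal t + ENNReal.ofReal a * (ENNReal.ofReal c *
              ENNReal.ofReal (e / (4 * c) * t)
            + ENNReal.ofReal (∑ i, ∫ ω, g i (ω t) ∂chain.P (x, y))) := by
            rw [ENNReal.ofReal_natCast]
            gcongr
        _ = ENNReal.ofReal (t + a * (c * (e / (4 * c) * t)
            + ∑ i, ∫ ω, g i (ω t) ∂chain.P (x, y))) := by
            have p1 : 0 ≤ c * (e / (4 * c) * t) := by positivity
            have p2 := hgi_nonneg t (x, y)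
            rw [← ENNReal.ofReal_mul hc1.le, ← ENNReal.ofReal_add p1 p2,
              ← ENNReal.ofReal_mul (by linarith), ← ENNReal.ofReal_add (by positivity)
              (mul_nonneg (by linarith) (add_nonneg p1 p2))]
        _ ≤ _ := by
            refine ENNReal.ofReal_le_ofReal ?_
            have p3 : c * (e / (4 * c) * t) = e / 4 * t := by field_simp
            rw [p3]
            have p4 : a * (e / 4 * t + ∑ i, ∫ ω, g i (ω t) ∂chain.P (x, y))
                ≤ a * (e / 4 * t + (∑ i, g i (x, y) - e / 2 * t)) := by
              gcongr
            have p5 : (1 : ℝ) * t ≤ a * (e / 4) * t :=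
              mul_le_mul_of_nonneg_right hae (Nat.cast_nonneg t)
            linarith
    · simp only [hx, if_false]
      rw [hWint]
      have h1 := FST.L1_step XC hV hx
      have h2 := hgup 1 (x, y)
      have h3 : ENNReal.ofReal (∑ i, ∫ ω, g i (ω 1) ∂chain.P (x, y)) + 1
          ≤ ENNReal.ofReal (∑ i, g i (x, y)) + ENNReal.ofReal c := by
        rw [← ENNReal.ofReal_add (hgs0 _) hc1.le, ← ENNReal.ofReal_one,
          ← ENNReal.ofReal_add (hgi_nonneg _ _) zero_le_one]
        refine ENNReal.ofReal_le_ofReal ?_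
        simp at h2
        linarith
      have ha1' : (1 : ℝ≥0∞) ≤ ENNReal.ofReal a := by
        rw [← ENNReal.ofReal_one]; exact ENNReal.ofReal_le_ofReal ha1
      set A := ENNReal.ofReal a
      set cE := ENNReal.ofReal c
      set EL := ∫⁻ ω, L1fun XC V (ω 1) ∂XC.P x
      set Eg := ENNReal.ofReal (∑ i, ∫ ω, g i (ω 1) ∂chain.P (x, y))
      calc ((1 : ℕ) : ℝ≥0∞) + A * (cE * EL + Eg) ≤ A * 1 + A * (cE * EL + Eg) := by
            gcongr; simpa using ha1'
        _ = A * (cE * EL + (Eg + 1)) := by ring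
        _ ≤ A * (cE * EL + (ENNReal.ofReal (∑ i, g i (x, y)) + cE)) := by gcongr
        _ = A * (cE * (1 + EL) + ENNReal.ofReal (∑ i, g i (x, y))) := by ring
        _ ≤ W (x, y) := by
            simp only [hW]
            gcongr
  -- mean hitting times from `V × Y`
  have hVbound : ∀ x ∈ V, ∀ y, ∫⁻ ω, hitTime D ω ∂chain.P (x, y) ≤ t + ENNReal.ofReal a *
      (ENNReal.ofReal c * ENNReal.ofReal (e / (4 * c) * t)
        + ENNReal.ofReal (∑ i, g i (x, y) + M * (t * u))) := by
    intro x hx y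
    refine (FST.lintegral_hit_le chain hD (FST.measurable_hitTime hD) hfoster t
      (fun ω => FST.hitTime_le_shift' ω t ht1) (x, y)).trans ?_
    rw [hWint]
    have hl := hTL t (by omega) x hx
    have := hgup t (x, y)
    gcongr
  refine ⟨?_, t + ENNReal.ofReal a * (ENNReal.ofReal c * ENNReal.ofReal (e / (4 * c) * t)
        + ENNReal.ofReal (N1 + M * (t * u))), ?_, ?_⟩
  · intro z
    refine FST.ae_hit chain hD (E := V ×ˢ univ) (hV.prod MeasurableSet.univ) ?_ z ?_
    · rintro ⟨x, y⟩ ⟨hx, -⟩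
      refine (hVbound x hx y).trans_lt ?_
      refine ENNReal.add_lt_top.2 ⟨ENNReal.natCast_lt_top t, ENNReal.mul_lt_top ENNReal.ofReal_lt_top
        (ENNReal.add_lt_top.2 ⟨ENNReal.mul_lt_top ENNReal.ofReal_lt_top ENNReal.ofReal_lt_top,
          ENNReal.ofReal_lt_top⟩)⟩
    · obtain ⟨x, y⟩ := z
      have hP := XC.prob x
      have h1 : ∀ᵐ ω ∂XC.P x, hitTime V ω < ⊤ :=
        (mem_ae_iff_prob_eq_one (FST.measurable_hitTime hV measurableSet_Iio)).2 (hfin x)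
      rw [← hA0 x y] at h1
      filter_upwards [ae_of_ae_map hpm.aemeasurable h1] with ω hω
      simpa [hitTime] using hω
  · refine ENNReal.add_lt_top.2 ⟨ENNReal.natCast_lt_top t, ENNReal.mul_lt_top ENNReal.ofReal_lt_top
      (ENNReal.add_lt_top.2 ⟨ENNReal.mul_lt_top ENNReal.ofReal_lt_top ENNReal.ofReal_lt_top,
        ENNReal.ofReal_lt_top⟩)⟩
  · rintro ⟨x, y⟩ ⟨hx, hy⟩
    refine (hVbound x hx y).trans ?_
    have hy' : ∑ i, g i (x, y) ≤ N1 := hy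
    gcongr
end
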